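/- Littlewood-Richardson rule for factorial Schur functions: Let n ≥ 1, let θ be a skew diagram, and let μ be a partition with at most n parts. Then, in the polynomial ring ℤ[a_i, b_i : i ∈ ℤ][x_1,…,x_n], s_θ(x|b)·s_μ(x|a) = Σ_ν c^ν_{θμ}(a,b)·s_ν(x|a), where the sum is over all partitions ν with μ ⊆ ν, at most n parts, and |ν| ≤ |θ| + |μ|, and where c^ν_{θμ}(a,b) = Σ_{T ∈ 𝒯(θ,ν/μ)} ∏_{α unbarred} ((a_{ρ(α)})_{T(α)} − b_{T(α)+c(α)}). -/

import Mathlib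

open scoped BigOperators

namespace FactorialLR

/-- Column order on cells: right-most column first, top to bottom within a column. -/
def ColLT (a b : ℕ × ℕ) : Prop :=
  b.2 < a.2 ∨ (a.2 = b.2 ∧ a.1 < b.1)

instance (a b : ℕ × ℕ) : Decidable (ColLT a b) := by
  unfold ColLT; infer_instance

/-- The cells of the skew diagram `θo / θi`. -/
def skewCells (θi θo : YoungDiagram) : Finset (ℕ × ℕ) :=
  θo.cells \ θi.cells

/-- A filling of the cell set `s` with entries in `Fin n` (`0`-based, representing the
`1`-based entries `{1,…,n}`) is semistandard if it weakly increases along rows and strictly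
increases down columns. -/
def IsSsyt {n : ℕ} (s : Finset (ℕ × ℕ)) (T : s → Fin n) : Prop :=
  (∀ c c' : s, (c : ℕ × ℕ).1 = (c' : ℕ × ℕ).1 → (c : ℕ × ℕ).2 ≤ (c' : ℕ × ℕ).2 → T c ≤ T c') ∧
  (∀ c c' : s, (c : ℕ × ℕ).1 < (c' : ℕ × ℕ).1 → (c : ℕ × ℕ).2 = (c' : ℕ × ℕ).2 → T c < T c')

/-- The factorial Schur-type polynomial attached to a (possibly skew) cell set `s`:
`Σ_T ∏_{α ∈ s} (x_{T(α)} − a_{T(α)+c(α)})`, where `T` runs over semistandard fillings of `s`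
with entries in `{1,…,n}` (stored `0`-based) and `c(α) = j − i` is the content of `α = (i,j)`.
Taking `a = 0` gives the ordinary Schur polynomial. -/
noncomputable def sgen {A : Type} [CommRing A] (n : ℕ) (s : Finset (ℕ × ℕ))
    (x : Fin n → A) (a : ℤ → A) : A :=
  ∑ᶠ T ∈ {T : s → Fin n | IsSsyt s T},
    ∏ c : s, (x (T c) - a ((T c : ℤ) + 1 + ((c : ℕ × ℕ).2 : ℤ) - ((c : ℕ × ℕ).1 : ℤ)))

/-- The `n`-tuple `a_ρ = (a_{ρ_1+n}, a_{ρ_2+n-1}, …, a_{ρ_n+1})`; the `i`-th entry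
(`0`-based `i`) is `a_{ρ_{i+1}+n-(i+1)+1}`. -/
noncomputable def subA {A : Type} [CommRing A] (n : ℕ) (a : ℤ → A) (ρ : YoungDiagram) :
    Fin n → A :=
  fun i => a ((ρ.rowLen i : ℤ) + (n : ℤ) - (i : ℤ))

/-- `μ → ν` : `ν` is obtained from `μ` by adding a single cell. -/
def Covers (μ ν : YoungDiagram) : Prop :=
  μ ≤ ν ∧ ν.card = μ.card + 1

/-- Chains `μ = ρ⁽⁰⁾ → ρ⁽¹⁾ → ⋯ → ρ⁽ˡ⁾ = ν` of Young diagrams, encoded as lists. -/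
def chainSet (μ ν : YoungDiagram) : Set (List YoungDiagram) :=
  {L | L.Chain' Covers ∧ L.head? = some μ ∧ L.getLast? = some ν}

/-- The row (`0`-based) of the unique cell of `τ / σ`, when `σ → τ`. -/
def stepRow (σ τ : YoungDiagram) : ℕ :=
  (τ.cells \ σ.cells).sup Prod.fst

/-- The set `𝒯(θ,R)` for a sequence `R` (encoded as the list `L`): pairs `(T,β)` where `T`
is a semistandard filling of `s` and `β` lists the barred cells `α_1 < ⋯ < α_l` in column
order, with `T(α_i) = r_i` (the row of `ρ⁽ⁱ⁾/ρ⁽ⁱ⁻¹⁾`). -/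
def TSet {n : ℕ} (s : Finset (ℕ × ℕ)) (L : List YoungDiagram) :
    Set ((s → Fin n) × (Fin (L.length - 1) → s)) :=
  {p | IsSsyt s p.1 ∧
    (∀ i j : Fin (L.length - 1), i < j → ColLT (p.2 i : ℕ × ℕ) (p.2 j : ℕ × ℕ)) ∧
    (∀ i : Fin (L.length - 1),
      (p.1 (p.2 i) : ℕ) = stepRow (L.getD (i : ℕ) ⊥) (L.getD ((i : ℕ) + 1) ⊥))}

/-- For an unbarred cell `c`, `ρ(c) = ρ⁽ⁱ⁾` where `i` is maximal with `α_i < c` in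
column order, i.e. `i` is the number of barred cells preceding `c`. -/
def rhoOf {s : Finset (ℕ × ℕ)} (L : List YoungDiagram)
    (β : Fin (L.length - 1) → s) (c : s) : YoungDiagram :=
  L.getD ((Finset.univ.filter
    (fun i : Fin (L.length - 1) => ColLT (β i : ℕ × ℕ) (c : ℕ × ℕ))).card) ⊥

/-- `𝒮(R) = Σ_{T ∈ 𝒯(θ,R)} ∏_{α unbarred} ((a_{ρ(α)})_{T(α)} − b_{T(α)+c(α)})`. -/
noncomputable def Sbar {A : Type} [CommRing A] (n : ℕ) (s : Finset (ℕ × ℕ))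
    (a b : ℤ → A) (L : List YoungDiagram) : A :=
  ∑ᶠ p ∈ TSet (n := n) s L,
    ∏ c : s,
      if ∃ i, p.2 i = c then 1
      else subA n a (rhoOf L p.2 c) (p.1 c)
            - b ((p.1 c : ℤ) + 1 + ((c : ℕ × ℕ).2 : ℤ) - ((c : ℕ × ℕ).1 : ℤ))

section Det
variable {A : Type} [CommRing A]

/-- Factorial power. -/
def pw (a : ℤ → A) (x : A) (k : ℕ) : A := ∏ t ∈ Finset.range k, (x - a ((t : ℤ) + 1))

lemma pw_succ (a : ℤ → A) (x : A) (k : ℕ) :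
    pw a x (k+1) = pw a x k * (x - a ((k : ℤ) + 1)) := by
  simp [pw, Finset.prod_range_succ]

lemma pw_sub (a : ℤ → A) (y z : A) (l k : ℕ) (h : l ≤ k) :
    pw a y k - (∏ t ∈ Finset.Ico l k, (z - a ((t : ℤ) + 1))) * pw a y l =
      (y - z) * ∑ p ∈ Finset.Ico l k, (∏ t ∈ Finset.Ico (p+1) k, (z - a ((t : ℤ) + 1))) * pw a y p := by
  induction k, h using Nat.le_induction with
  | base => simp
  | succ k hk ih =>
    rw [Finset.sum_Ico_succ_top hk, Finset.prod_Ico_succ_top hk, pw_succ]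
    have : ∑ p ∈ Finset.Ico l k, (∏ t ∈ Finset.Ico (p+1) (k+1), (z - a ((t : ℤ) + 1))) * pw a y p
        = (z - a ((k : ℤ) + 1)) *
          ∑ p ∈ Finset.Ico l k, (∏ t ∈ Finset.Ico (p+1) k, (z - a ((t : ℤ) + 1))) * pw a y p := by
      rw [Finset.mul_sum]
      refine Finset.sum_congr rfl fun p hp => ?_
      rw [Finset.mem_Ico] at hp
      rw [Finset.prod_Ico_succ_top (by omega)]
      ring
    rw [this]
    simp only [Finset.Ico_self, Finset.prod_empty]
    linear_combination (z - a ((k : ℤ) + 1)) * ih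

/-- The alternant determinant. -/
def Dd (a : ℤ → A) (n : ℕ) (κ : Fin n → ℕ) (y : Fin n → A) : A :=
  Matrix.det (Matrix.of fun i j : Fin n => pw a (y j) (κ i))

lemma det_branch (a : ℤ → A) (n : ℕ) (κ : Fin (n+1) → ℕ) (hκ : Monotone κ) (y : Fin (n+1) → A) :
    Dd a (n+1) κ y = pw a (y 0) (κ 0) * (∏ j : Fin n, (y j.succ - y 0)) *
      ∑ p ∈ Fintype.piFinset (fun i : Fin n => Finset.Ico (κ i.castSucc) (κ i.succ)),
        (∏ i : Fin n, ∏ t ∈ Finset.Ico (p i + 1) (κ i.succ), (y 0 - a ((t : ℤ) + 1))) *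
          Dd a n p (fun j => y j.succ) := by
  classical
  set c : Fin n → A := fun i => ∏ t ∈ Finset.Ico (κ i.castSucc) (κ i.succ), (y 0 - a ((t : ℤ) + 1))
    with hc
  set M : Matrix (Fin (n+1)) (Fin (n+1)) A := Matrix.of fun i j => pw a (y j) (κ i) with hM
  set B : Matrix (Fin (n+1)) (Fin (n+1)) A :=
    Matrix.of (Fin.cases (fun j => M 0 j) (fun i j => M i.succ j - c i * M i.castSucc j)) with hB
  have h1 : M.det = B.det := by
    refine Matrix.det_eq_of_forall_row_eq_smul_add_pred c (fun j => by simp [hB]) (fun i j => ?_)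
    simp [hB]
  have hB0 : ∀ i : Fin n, B i.succ 0 = 0 := by
    intro i
    simp only [hB, hM, Matrix.of_apply, Fin.cases_succ]
    rw [pw_sub a (y 0) (y 0) _ _ (hκ (Fin.castSucc_lt_succ).le)]
    simp
  have hBs : B.submatrix Fin.succ Fin.succ = Matrix.of fun i j : Fin n =>
      (y j.succ - y 0) * (Matrix.of fun i j : Fin n => ∑ p ∈ Finset.Ico (κ i.castSucc) (κ i.succ),
        (∏ t ∈ Finset.Ico (p+1) (κ i.succ), (y 0 - a ((t : ℤ) + 1))) * pw a (y j.succ) p) i j := by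
    ext i j
    simp only [hB, hM, Matrix.of_apply, Fin.cases_succ, Matrix.submatrix_apply]
    rw [pw_sub a _ (y 0) _ _ (hκ (Fin.castSucc_lt_succ).le)]
  have h2 : B.det = pw a (y 0) (κ 0) * (B.submatrix Fin.succ Fin.succ).det := by
    rw [Matrix.det_succ_column_zero, Fin.sum_univ_succ]
    simp only [hB0]
    simp only [hB, hM]
    simp
  unfold Dd
  rw [← hM, h1, h2, hBs, Matrix.det_mul_row, mul_assoc]
  congr 2
  have h3 : (Matrix.of fun i j : Fin n => ∑ p ∈ Finset.Ico (κ i.castSucc) (κ i.succ),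
        (∏ t ∈ Finset.Ico (p+1) (κ i.succ), (y 0 - a ((t : ℤ) + 1))) * pw a (y j.succ) p) =
      fun i => ∑ p ∈ Finset.Ico (κ i.castSucc) (κ i.succ),
        ((∏ t ∈ Finset.Ico (p+1) (κ i.succ), (y 0 - a ((t : ℤ) + 1))) •
          (fun j => pw a (y j.succ) p : Fin n → A)) := by
    ext i j
    simp [Finset.sum_apply]
  show Matrix.detRowAlternating.toMultilinearMap _ = _
  rw [h3, MultilinearMap.map_sum_finset]
  refine Finset.sum_congr rfl fun p hp => ?_
  rw [MultilinearMap.map_smul_univ]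
  rfl

end Det


section Branch
variable {A : Type} [CommRing A]

open Classical in
lemma sgen_eq (n : ℕ) (s : Finset (ℕ × ℕ)) (x : Fin n → A) (a : ℤ → A) :
    sgen n s x a = ∑ T ∈ Finset.univ.filter (fun T : s → Fin n => IsSsyt s T),
      ∏ c : s, (x (T c) - a ((T c : ℤ) + 1 + ((c : ℕ × ℕ).2 : ℤ) - ((c : ℕ × ℕ).1 : ℤ))) := by
  unfold sgen
  rw [← finsum_mem_coe_finset]
  congr 1
  ext T
  simp

/-- The cells of the diagram with row lengths `l`. -/
def cellsOf (n : ℕ) (l : Fin n → ℕ) : Finset (ℕ × ℕ) :=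
  Finset.univ.biUnion fun i : Fin n => (Finset.range (l i)).image fun j => ((i : ℕ), j)

lemma mem_cellsOf {n : ℕ} {l : Fin n → ℕ} {c : ℕ × ℕ} :
    c ∈ cellsOf n l ↔ ∃ h : c.1 < n, c.2 < l ⟨c.1, h⟩ := by
  obtain ⟨i, j⟩ := c
  simp only [cellsOf, Finset.mem_biUnion, Finset.mem_univ, true_and, Finset.mem_image,
    Finset.mem_range, Prod.mk.injEq]
  constructor
  · rintro ⟨r, j, h, rfl, rfl⟩
    exact ⟨r.2, h⟩
  · rintro ⟨h, h'⟩
    exact ⟨⟨i, h⟩, j, h', rfl, rfl⟩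

lemma downset_eq_range (S : Finset ℕ) (h : ∀ i j, i ≤ j → j ∈ S → i ∈ S) (j : ℕ) :
    j ∈ S ↔ j < S.card := by
  constructor
  · intro hj
    have : Finset.range (j+1) ⊆ S := fun i hi => h i j (by simp at hi; omega) hj
    have := Finset.card_le_card this
    simp at this; omega
  · intro hj
    by_contra hn
    have : S ⊆ Finset.range j := by
      intro i hi
      simp
      by_contra hh
      exact hn (h j i (by omega) hi)
    have := Finset.card_le_card this
    simp at this; omega

/-- interlacing partitions -/
def ilace (n : ℕ) (l : Fin (n+1) → ℕ) : Finset (Fin n → ℕ) :=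
  Fintype.piFinset fun i : Fin n => Finset.Icc (l i.succ) (l i.castSucc)

lemma cellsOf_sub {n : ℕ} {l : Fin (n+1) → ℕ} {m : Fin n → ℕ} (hm : m ∈ ilace n l)
    {c : ℕ × ℕ} (hc : c ∈ cellsOf n m) : c ∈ cellsOf (n+1) l := by
  rw [mem_cellsOf] at *
  obtain ⟨h, h'⟩ := hc
  simp only [ilace, Fintype.mem_piFinset, Finset.mem_Icc] at hm
  refine ⟨by omega, ?_⟩
  have := (hm ⟨c.1, h⟩).2
  simp at this
  omega

lemma ssyt_row_le {n : ℕ} {l : Fin n → ℕ} (hl : Antitone l) (T : cellsOf n l → Fin n)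
    (hT : IsSsyt _ T) : ∀ (i j : ℕ) (h : (i, j) ∈ cellsOf n l), i ≤ T ⟨(i, j), h⟩ := by
  intro i
  induction i with
  | zero => simp
  | succ i ih =>
    intro j h
    have h0 : (i, j) ∈ cellsOf n l := by
      rw [mem_cellsOf] at *
      obtain ⟨h, h'⟩ := h
      refine ⟨by simp at *; omega, lt_of_lt_of_le h' (hl ?_)⟩
      simp
    have := ih j h0
    have := hT.2 ⟨(i, j), h0⟩ ⟨(i+1, j), h⟩ (by simp) rfl
    rw [Fin.lt_def] at this
    omega

open Classical in
lemma exists_mu {n : ℕ} {l : Fin (n+1) → ℕ} (hl : Antitone l)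
    (T : cellsOf (n+1) l → Fin (n+1)) (hT : IsSsyt _ T) :
    ∃ m ∈ ilace n l, ∀ c : cellsOf (n+1) l, T c = Fin.last n ↔ (c : ℕ × ℕ) ∉ cellsOf n m := by
  set S : Fin n → Finset ℕ := fun i =>
    (Finset.univ.filter (fun c : cellsOf (n+1) l => c.1.1 = i ∧ T c ≠ Fin.last n)).image
      (fun c => c.1.2) with hS
  have memS : ∀ i j, j ∈ S i ↔ ∃ h : ((i : ℕ), j) ∈ cellsOf (n+1) l, T ⟨_, h⟩ ≠ Fin.last n := by
    intro i j
    simp only [hS, Finset.mem_image, Finset.mem_filter, Finset.mem_univ, true_and]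
    constructor
    · rintro ⟨⟨⟨i', j'⟩, hc⟩, ⟨h1, h2⟩, h3⟩
      simp only at h1 h3
      subst h1; subst h3
      exact ⟨hc, h2⟩
    · rintro ⟨h, h'⟩
      exact ⟨_, ⟨rfl, h'⟩, rfl⟩
  have hdown : ∀ i, ∀ j j', j ≤ j' → j' ∈ S i → j ∈ S i := by
    intro i j j' hj hj'
    rw [memS] at *
    obtain ⟨h, h'⟩ := hj'
    have h0 : ((i : ℕ), j) ∈ cellsOf (n+1) l := by
      rw [mem_cellsOf] at *
      obtain ⟨h, h''⟩ := h
      exact ⟨h, lt_of_le_of_lt hj h''⟩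
    refine ⟨h0, ?_⟩
    have := hT.1 ⟨_, h0⟩ ⟨_, h⟩ rfl hj
    intro h2
    rw [h2] at this
    exact h' (le_antisymm (Fin.le_last _) this)
  refine ⟨fun i => (S i).card, ?_, ?_⟩
  · simp only [ilace, Fintype.mem_piFinset, Finset.mem_Icc]
    intro i
    constructor
    · by_contra hlt
      push Not at hlt
      have : (S i).card ∉ S i := by
        rw [downset_eq_range _ (hdown i)]; omega
      apply this
      rw [memS]
      have h1 : ((i : ℕ) + 1, (S i).card) ∈ cellsOf (n+1) l := by
        rw [mem_cellsOf]
        exact ⟨by simp, hlt⟩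
      have h0 : ((i : ℕ), (S i).card) ∈ cellsOf (n+1) l := by
        rw [mem_cellsOf]
        refine ⟨by simp only; omega, lt_of_lt_of_le hlt (hl ?_)⟩
        rw [Fin.le_def]; simp
      refine ⟨h0, ?_⟩
      have := hT.2 ⟨_, h0⟩ ⟨_, h1⟩ (by simp) rfl
      exact (lt_of_lt_of_le this (Fin.le_last _)).ne
    · have : S i ⊆ Finset.range (l i.castSucc) := by
        intro j hj
        rw [memS] at hj
        obtain ⟨h, -⟩ := hj
        rw [mem_cellsOf] at h
        obtain ⟨h, h'⟩ := h
        rw [Finset.mem_range]; exact h'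
      simpa using Finset.card_le_card this
  · rintro ⟨⟨i, j⟩, hc⟩
    rw [mem_cellsOf, not_exists]
    by_cases hi : i < n
    · have := memS ⟨i, hi⟩ j
      rw [downset_eq_range _ (hdown _)] at this
      simp only [hi, forall_true_left]
      rw [this]
      simp [hc]
    · simp only [hi, IsEmpty.forall_iff, iff_true]
      have := ssyt_row_le hl T hT i j hc
      rw [Fin.ext_iff, Fin.val_last]
      have := (T ⟨(i, j), hc⟩).2
      omega

lemma mu_unique {n : ℕ} {l : Fin (n+1) → ℕ} {m m' : Fin n → ℕ}
    (hm : m ∈ ilace n l) (hm' : m' ∈ ilace n l)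
    (h : ∀ c ∈ cellsOf (n+1) l, c ∉ cellsOf n m ↔ c ∉ cellsOf n m') : m = m' := by
  have key : ∀ m m' : Fin n → ℕ, m ∈ ilace n l → m' ∈ ilace n l →
    (∀ c ∈ cellsOf (n+1) l, c ∉ cellsOf n m ↔ c ∉ cellsOf n m') → ∀ i, m i ≤ m' i := by
    intro m m' hm hm' h i
    by_contra hlt
    push Not at hlt
    have h1 : ((i : ℕ), m' i) ∈ cellsOf n m := by
      rw [mem_cellsOf]; exact ⟨i.2, hlt⟩
    have h2 := (not_iff_not.mp (h _ (cellsOf_sub hm h1))).mp h1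
    rw [mem_cellsOf] at h2
    obtain ⟨_, h2⟩ := h2
    simp at h2
  funext i
  exact le_antisymm (key m m' hm hm' h i) (key m' m hm' hm (fun c hc => (h c hc).symm) i)

open Classical in
lemma fiber_sum {n : ℕ} {l : Fin (n+1) → ℕ} (hl : Antitone l) (x : Fin (n+1) → A) (a : ℤ → A)
    (m : Fin n → ℕ) (hm : m ∈ ilace n l) :
    ∑ T ∈ Finset.univ.filter (fun T : cellsOf (n+1) l → Fin (n+1) => IsSsyt _ T ∧
        ∀ c : cellsOf (n+1) l, T c = Fin.last n ↔ (c : ℕ × ℕ) ∉ cellsOf n m),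
      ∏ c : cellsOf (n+1) l,
        (x (T c) - a ((T c : ℤ) + 1 + ((c : ℕ × ℕ).2 : ℤ) - ((c : ℕ × ℕ).1 : ℤ)))
    = sgen n (cellsOf n m) (fun i => x i.castSucc) a *
      ∏ c ∈ cellsOf (n+1) l \ cellsOf n m,
        (x (Fin.last n) - a ((n : ℤ) + 1 + ((c : ℕ × ℕ).2 : ℤ) - ((c : ℕ × ℕ).1 : ℤ))) := by
  rw [sgen_eq, Finset.sum_mul]
  symm
  have hsub : cellsOf n m ⊆ cellsOf (n+1) l := fun c hc => cellsOf_sub hm hc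
  refine Finset.sum_bij (fun T' _ => fun c : cellsOf (n+1) l =>
    if h : (c : ℕ × ℕ) ∈ cellsOf n m then (T' ⟨c, h⟩).castSucc else Fin.last n) ?_ ?_ ?_ ?_
  · intro T' hT'
    simp only [Finset.mem_filter, Finset.mem_univ, true_and] at hT' ⊢
    refine ⟨⟨?_, ?_⟩, ?_⟩
    · rintro ⟨⟨i, j⟩, hc⟩ ⟨⟨i', j'⟩, hc'⟩ h1 h2
      simp only at h1 h2
      subst h1
      dsimp only
      split_ifs with h3 h4 h4
      · exact Fin.castSucc_le_castSucc_iff.mpr (hT'.1 ⟨_, h3⟩ ⟨_, h4⟩ rfl h2)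
      · exact Fin.le_last _
      · exfalso
        apply h3
        rw [mem_cellsOf] at *
        obtain ⟨h4, h4'⟩ := h4
        exact ⟨h4, lt_of_le_of_lt h2 h4'⟩
      · exact le_rfl
    · rintro ⟨⟨i, j⟩, hc⟩ ⟨⟨i', j'⟩, hc'⟩ h1 h2
      simp only at h1 h2
      subst h2
      dsimp only
      have h3 : (i, j) ∈ cellsOf n m := by
        rw [mem_cellsOf] at hc' ⊢
        obtain ⟨h4, h4'⟩ := hc'
        simp only at h4 h4'
        have hi : i < n := by omega
        refine ⟨hi, ?_⟩
        simp only [ilace, Fintype.mem_piFinset, Finset.mem_Icc] at hm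
        refine lt_of_lt_of_le (lt_of_lt_of_le h4' (hl ?_)) (hm ⟨i, hi⟩).1
        rw [Fin.le_def]; simp; omega
      rw [dif_pos h3]
      split_ifs with h4
      · exact Fin.castSucc_lt_castSucc_iff.mpr (hT'.2 ⟨_, h3⟩ ⟨_, h4⟩ h1 rfl)
      · exact Fin.castSucc_lt_last _
    · rintro ⟨c, hc⟩
      dsimp only
      split_ifs with h
      · simp [h, Fin.ext_iff]
        have := (T' ⟨c, h⟩).2
        omega
      · simp [h]
  · intro T1 h1 T2 h2 h
    funext c
    have := congrFun h ⟨c, hsub c.2⟩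
    simpa using this
  · intro T hT
    simp only [Finset.mem_filter, Finset.mem_univ, true_and] at hT
    have hne : ∀ c : cellsOf n m, T ⟨c, hsub c.2⟩ ≠ Fin.last n := fun c hc =>
      (hT.2 _).mp hc c.2
    refine ⟨fun c => (T ⟨c, hsub c.2⟩).castPred (hne c), ?_, ?_⟩
    · simp only [Finset.mem_filter, Finset.mem_univ, true_and]
      refine ⟨fun c c' h1 h2 => ?_, fun c c' h1 h2 => ?_⟩
      · exact hT.1.1 ⟨c, hsub c.2⟩ ⟨c', hsub c'.2⟩ h1 h2
      · exact hT.1.2 ⟨c, hsub c.2⟩ ⟨c', hsub c'.2⟩ h1 h2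
    · funext c
      dsimp only
      split_ifs with h
      · simp
      · exact ((hT.2 c).mpr h).symm
  · intro T' hT'
    dsimp only
    set G : ℕ × ℕ → A := fun c => if h : c ∈ cellsOf n m then
        (x (T' ⟨c, h⟩).castSucc - a (((T' ⟨c, h⟩ : ℕ) : ℤ) + 1 + (c.2 : ℤ) - (c.1 : ℤ)))
      else (x (Fin.last n) - a ((n : ℤ) + 1 + (c.2 : ℤ) - (c.1 : ℤ))) with hG
    have e1 : ∀ c : cellsOf (n+1) l, (x (if h : (c : ℕ × ℕ) ∈ cellsOf n m then
        (T' ⟨c, h⟩).castSucc else Fin.last n) - a ((((if h : (c : ℕ × ℕ) ∈ cellsOf n m then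
        (T' ⟨c, h⟩).castSucc else Fin.last n : Fin (n+1)) : ℕ) : ℤ) + 1 + ((c : ℕ × ℕ).2 : ℤ)
          - ((c : ℕ × ℕ).1 : ℤ))) = G c := by
      intro c
      simp only [hG]
      split_ifs with h <;> simp
    rw [Finset.prod_congr rfl (fun c _ => e1 c), Finset.prod_coe_sort (cellsOf (n+1) l) G,
      ← Finset.prod_sdiff hsub, mul_comm]
    congr 1
    · refine Finset.prod_congr rfl fun c hc => ?_
      rw [Finset.mem_sdiff] at hc
      simp [hG, hc.2]
    · rw [← Finset.prod_coe_sort (cellsOf n m) G]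
      refine Finset.prod_congr rfl fun c _ => ?_
      simp [hG]

open Classical in
lemma sgen_branch {n : ℕ} {l : Fin (n+1) → ℕ} (hl : Antitone l) (x : Fin (n+1) → A) (a : ℤ → A) :
    sgen (n+1) (cellsOf (n+1) l) x a = ∑ m ∈ ilace n l,
      sgen n (cellsOf n m) (fun i => x i.castSucc) a *
      ∏ c ∈ cellsOf (n+1) l \ cellsOf n m,
        (x (Fin.last n) - a ((n : ℤ) + 1 + ((c : ℕ × ℕ).2 : ℤ) - ((c : ℕ × ℕ).1 : ℤ))) := by
  symm
  rw [Finset.sum_congr rfl fun m hm => (fiber_sum hl x a m hm).symm, sgen_eq]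
  rw [Finset.sum_congr rfl (fun m _ => by rw [← Finset.filter_filter, Finset.sum_filter])]
  rw [Finset.sum_comm]
  refine Finset.sum_congr rfl fun T hT => ?_
  simp only [Finset.mem_filter, Finset.mem_univ, true_and] at hT
  obtain ⟨m, hm, h⟩ := exists_mu hl T hT
  rw [Finset.sum_eq_single m, if_pos h]
  · intro m' hm' hne
    rw [if_neg]
    intro h'
    exact hne (mu_unique hm' hm fun c hc => (h' ⟨c, hc⟩).symm.trans (h ⟨c, hc⟩))
  · intro h2; exact absurd hm h2

lemma prod_strip {n : ℕ} {l : Fin (n+1) → ℕ} {m : Fin n → ℕ} (_ : m ∈ ilace n l)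
    (f : ℕ × ℕ → A) :
    ∏ c ∈ cellsOf (n+1) l \ cellsOf n m, f c =
      (∏ i : Fin n, ∏ j ∈ Finset.Ico (m i) (l i.castSucc), f (i, j)) *
        ∏ j ∈ Finset.range (l (Fin.last n)), f (n, j) := by
  have e : cellsOf (n+1) l \ cellsOf n m = Finset.univ.biUnion fun i : Fin (n+1) =>
      (Finset.Ico ((Fin.snoc m 0 : Fin (n+1) → ℕ) i) (l i)).image fun j => ((i : ℕ), j) := by
    ext ⟨i, j⟩
    rw [Finset.mem_sdiff, mem_cellsOf, mem_cellsOf]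
    simp only [Finset.mem_biUnion, Finset.mem_univ, true_and, Finset.mem_image, Finset.mem_Ico,
      Prod.mk.injEq, not_exists, not_lt]
    constructor
    · rintro ⟨⟨h1, h2⟩, h3⟩
      refine ⟨⟨i, h1⟩, j, ⟨?_, h2⟩, rfl, rfl⟩
      by_cases hi : i < n
      · simpa [Fin.snoc, hi] using h3 hi
      · simp [Fin.snoc, hi]
    · rintro ⟨r, j, ⟨h1, h2⟩, rfl, rfl⟩
      refine ⟨⟨r.2, h2⟩, fun h => ?_⟩
      simpa [Fin.snoc, h, Fin.castLT] using h1
  rw [e, Finset.prod_biUnion]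
  · simp_rw [Finset.prod_image (f := f) (fun (a : ℕ) _ b _ h => (Prod.mk.inj h).2)]
    rw [Fin.prod_univ_castSucc]
    simp
  · intro i _ j _ hij
    rw [Function.onFun, Finset.disjoint_left]
    rintro ⟨c, d⟩ h1 h2
    simp only [Finset.mem_image, Prod.mk.injEq] at h1 h2
    obtain ⟨_, _, h1, _⟩ := h1
    obtain ⟨_, _, h2, _⟩ := h2
    exact hij (Fin.ext (h1.trans h2.symm))

/-- exponents attached to row lengths, in increasing order -/
def kap (n : ℕ) (l : Fin n → ℕ) : Fin n → ℕ := fun i => l i.rev + i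

lemma det_branch' (a : ℤ → A) (n : ℕ) (l : Fin (n+1) → ℕ) (hl : Antitone l) (x : Fin (n+1) → A) :
    Dd a (n+1) (kap _ l) (fun i => x i.rev) =
      (∏ j : Fin n, (x j.castSucc - x (Fin.last n))) *
      ∑ m ∈ ilace n l,
        (Dd a n (kap _ m) (fun i => x i.rev.castSucc)) *
          ∏ c ∈ cellsOf (n+1) l \ cellsOf n m,
        (x (Fin.last n) - a ((n : ℤ) + 1 + ((c : ℕ × ℕ).2 : ℤ) - ((c : ℕ × ℕ).1 : ℤ))) := by
  rw [det_branch]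
  swap
  · intro i j hij
    have := hl (Fin.rev_le_rev.mpr hij)
    simp only [kap]
    rw [Fin.le_def] at hij
    omega
  have h0 : (Fin.rev (0 : Fin (n+1))) = Fin.last n := by simp
  rw [h0]
  have h1 : ∏ j : Fin n, (x (j.succ).rev - x (Fin.last n)) =
      ∏ j : Fin n, (x j.castSucc - x (Fin.last n)) := by
    rw [← Equiv.prod_comp Fin.revPerm]
    refine Finset.prod_congr rfl fun j _ => ?_
    simp [Fin.rev_succ]
  rw [h1, mul_comm (pw _ _ _), mul_assoc, Finset.mul_sum]
  congr 1
  symm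
  refine Finset.sum_bij (fun m _ => fun i => m i.rev + i) ?_ ?_ ?_ ?_
  · intro m hm
    simp only [ilace, Fintype.mem_piFinset, Finset.mem_Icc, Finset.mem_Ico, kap] at hm ⊢
    intro i
    have := hm i.rev
    rw [Fin.rev_castSucc, Fin.rev_succ]
    simp
    omega
  · intro m hm m' hm' h
    funext i
    have := congrFun h i.rev
    simpa using this
  · intro p hp
    simp only [Fintype.mem_piFinset, Finset.mem_Ico, kap] at hp
    refine ⟨fun i => p i.rev - i.rev, ?_, ?_⟩
    · simp only [ilace, Fintype.mem_piFinset, Finset.mem_Icc]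
      intro i
      have := hp i.rev
      rw [Fin.rev_castSucc, Fin.rev_succ, Fin.rev_rev] at this
      simp only [Fin.val_castSucc, Fin.val_succ] at this
      omega
    · funext i
      have := hp i
      simp only [Fin.rev_rev]
      simp only [Fin.val_castSucc, Fin.val_succ] at this
      omega
  · intro m hm
    rw [prod_strip hm]
    have e1 : ∏ j ∈ Finset.range (l (Fin.last n)), (x (Fin.last n) - a ((n : ℤ) + 1 + (((n, j) : ℕ × ℕ).2 : ℤ) - (((n, j) : ℕ × ℕ).1 : ℤ))) = pw a (x (Fin.last n)) (kap _ l 0) := by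
      simp only [pw, kap, h0]
      refine Finset.prod_congr (by simp) fun j _ => ?_
      congr 2
      push_cast
      ring
    have e2 : ∏ i : Fin n, ∏ j ∈ Finset.Ico (m i) (l i.castSucc), (x (Fin.last n) - a ((n : ℤ) + 1 + ((((i : ℕ), j) : ℕ × ℕ).2 : ℤ) - ((((i : ℕ), j) : ℕ × ℕ).1 : ℤ))) =
       ∏ i : Fin n, ∏ t ∈ Finset.Ico ((m i.rev + i) + 1) (kap _ l i.succ), (x (Fin.last n) - a ((t : ℤ) + 1)) := by
      rw [← Equiv.prod_comp Fin.revPerm]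
      refine Finset.prod_congr rfl fun i _ => ?_
      simp only [kap, Fin.revPerm_apply, Fin.rev_succ]
      rw [show m i.rev + (i : ℕ) + 1 = m i.rev + ((i : ℕ) + 1) by ring, Fin.val_succ,
        ← Finset.prod_Ico_add']
      refine Finset.prod_congr rfl fun j _ => ?_
      have : ((i.rev : ℕ) : ℤ) = n - (i + 1) := by
        rw [Fin.val_rev]; have := i.2; push_cast [Nat.cast_sub (show (i:ℕ)+1 ≤ n by omega)]; ring
      congr 2
      simp only [this]
      push_cast
      ring
    rw [e1, e2]
    simp only [Fin.rev_succ]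
    unfold kap
    ring

lemma kap_zero (n : ℕ) : kap n (fun _ => 0) = fun i : Fin n => (i : ℕ) := by
  funext i; simp [kap]

lemma vand_rec (a : ℤ → A) (n : ℕ) (x : Fin (n+1) → A) :
    Dd a (n+1) (kap _ fun _ => 0) (fun i => x i.rev) =
      (∏ j : Fin n, (x j.castSucc - x (Fin.last n))) *
        (Dd a n (kap _ fun _ => 0) (fun i => x i.rev.castSucc)) := by
  rw [det_branch' a n _ (fun _ _ _ => le_rfl)]
  have : ilace n (fun _ => 0) = {fun _ => 0} := by
    ext m
    simp [ilace, funext_iff]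
  rw [this, Finset.sum_singleton, prod_strip (by rw [this]; simp)]
  simp

theorem bialternant (a : ℤ → A) (n : ℕ) : ∀ (l : Fin n → ℕ) (_ : Antitone l) (x : Fin n → A),
    Dd a n (kap _ fun _ => 0) (fun i => x i.rev) * sgen n (cellsOf n l) x a =
      Dd a n (kap _ l) (fun i => x i.rev) := by
  classical
  induction n with
  | zero =>
    intro l hl x
    have : IsEmpty (cellsOf 0 l) := ⟨fun c => by obtain ⟨h, _⟩ := mem_cellsOf.mp c.2; omega⟩
    rw [sgen_eq, Finset.filter_true_of_mem
      (fun T _ => ⟨fun c => this.elim c, fun c => this.elim c⟩)]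
    simp [Dd]
  | succ n ih =>
    intro l hl x
    rw [vand_rec, sgen_branch hl, det_branch' a n l hl, mul_assoc, Finset.mul_sum]
    congr 1
    refine Finset.sum_congr rfl fun m hm => ?_
    rw [← mul_assoc, ← ih m ?_ (fun i => x i.castSucc)]
    simp only [ilace, Fintype.mem_piFinset, Finset.mem_Icc] at hm
    refine antitone_iff_forall_lt.mpr fun i j hij => ?_
    refine (hm j).2.trans (le_trans (hl ?_) (hm i).1)
    rw [Fin.le_def]
    simp
    omega

theorem vand_ne_zero [IsDomain A] (a : ℤ → A) (n : ℕ) : ∀ (x : Fin n → A) (_ : Function.Injective x),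
    Dd a n (kap _ fun _ => 0) (fun i => x i.rev) ≠ 0 := by
  induction n with
  | zero => intro x _; simp [Dd]
  | succ n ih =>
    intro x hx
    rw [vand_rec]
    refine mul_ne_zero ?_ (ih (fun i => x i.castSucc) (hx.comp (Fin.castSucc_injective n)))
    rw [Finset.prod_ne_zero_iff]
    intro j _
    rw [sub_ne_zero]
    exact fun h => (Fin.castSucc_lt_last j).ne (hx h)

end Branch


section TwoRow
variable {A : Type} [CommRing A]

/-- `G` is closed under moving right inside `F`. -/
def UpIn (F G : Finset (ℕ × ℕ)) : Prop :=
  ∀ i j j', (i, j) ∈ G → (i, j') ∈ F → j ≤ j' → (i, j') ∈ G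

/-- two-letter weight -/
def zw (b : ℤ → A) (p : ℤ) (x y : A) (G : Finset (ℕ × ℕ)) (c : ℕ × ℕ) : A :=
  if c ∈ G then y - b (p + 1 + (c.2 : ℤ) - (c.1 : ℤ)) else x - b (p + (c.2 : ℤ) - (c.1 : ℤ))

open Classical in
/-- two-letter sums -/
noncomputable def Zs (b : ℤ → A) (p : ℤ) (x y : A) (F : Finset (ℕ × ℕ)) : A :=
  ∑ G ∈ F.powerset.filter (UpIn F), ∏ c ∈ F, zw b p x y G c

/-- row segment -/
def seg (i l k : ℕ) : Finset (ℕ × ℕ) := (Finset.Ico l k).image fun j => (i, j)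

lemma mem_seg {i l k : ℕ} {c : ℕ × ℕ} : c ∈ seg i l k ↔ c.1 = i ∧ l ≤ c.2 ∧ c.2 < k := by
  obtain ⟨u, v⟩ := c
  simp only [seg, Finset.mem_image, Finset.mem_Ico, Prod.mk.injEq]
  constructor
  · rintro ⟨j, h, rfl, rfl⟩; exact ⟨rfl, h⟩
  · rintro ⟨rfl, h⟩; exact ⟨v, h, rfl, rfl⟩

open Classical in
lemma Zs_step (b : ℤ → A) (p : ℤ) (x y : A) (F' : Finset (ℕ × ℕ)) (i l k : ℕ) (hlk : l ≤ k)
    (hF' : ∀ c ∈ F', c.1 ≠ i) :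
    Zs b p x y (F' ∪ seg i l (k+1)) =
      Zs b p x y (F' ∪ seg i l k) * (y - b (p + 1 + (k : ℤ) - (i : ℤ))) +
      Zs b p x y F' * ∏ j ∈ Finset.Ico l (k+1), (x - b (p + (j : ℤ) - (i : ℤ))) := by
  set u : ℕ × ℕ := (i, k) with hu
  have hu0 : u ∉ F' ∪ seg i l k := by
    simp only [Finset.mem_union, mem_seg, hu, not_or]
    exact ⟨fun h => hF' _ h rfl, by simp⟩
  have hF : F' ∪ seg i l (k+1) = insert u (F' ∪ seg i l k) := by
    ext ⟨c, d⟩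
    simp only [Finset.mem_union, mem_seg, Finset.mem_insert, hu, Prod.mk.injEq]
    constructor
    · rintro (h | ⟨rfl, h⟩)
      · tauto
      · by_cases hd : d = k
        · left; exact ⟨rfl, hd⟩
        · right; right; exact ⟨rfl, by omega⟩
    · rintro (⟨rfl, rfl⟩ | h | ⟨rfl, h⟩)
      · right; exact ⟨rfl, by omega⟩
      · tauto
      · right; exact ⟨rfl, by omega⟩
  rw [hF]
  unfold Zs
  rw [Finset.sum_filter, Finset.sum_powerset_insert hu0, add_comm]
  congr 1
  · rw [Finset.sum_filter, Finset.sum_mul]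
    refine Finset.sum_congr rfl fun G hG => ?_
    rw [Finset.mem_powerset] at hG
    have h1 : UpIn (insert u (F' ∪ seg i l k)) (insert u G) ↔ UpIn (F' ∪ seg i l k) G := by
      constructor
      · intro h r j j' h1 h2 h3
        have := h r j j' (Finset.mem_insert_of_mem h1) (Finset.mem_insert_of_mem h2) h3
        rw [Finset.mem_insert] at this
        rcases this with h4 | h4
        · rw [h4] at h2; exact absurd h2 hu0
        · exact h4
      · intro h r j j' h1 h2 h3
        rw [Finset.mem_insert] at h1 h2 ⊢
        rcases h2 with h2 | h2
        · exact Or.inl h2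
        · rcases h1 with h1 | h1
          · exfalso
            rw [hu, Prod.mk.injEq] at h1
            rw [Finset.mem_union, mem_seg] at h2
            rcases h2 with h2 | h2
            · exact hF' _ h2 h1.1
            · simp only at h2; omega
          · exact Or.inr (h r j j' h1 h2 h3)
    simp only [h1]
    split_ifs
    · rw [Finset.prod_insert hu0, mul_comm]
      congr 1
      · refine Finset.prod_congr rfl fun c hc => ?_
        have : c ≠ u := fun h => hu0 (h ▸ hc)
        simp [zw, this]
      · simp [zw, hu]
    · simp
  · rw [Finset.sum_mul, ← Finset.sum_filter]
    have hset : (F' ∪ seg i l k).powerset.filter (UpIn (insert u (F' ∪ seg i l k))) =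
        F'.powerset.filter (UpIn F') := by
      ext G
      simp only [Finset.mem_filter, Finset.mem_powerset]
      constructor
      · rintro ⟨h1, h2⟩
        have h3 : G ⊆ F' := by
          rintro ⟨r, j⟩ hc
          have := h1 hc
          rw [Finset.mem_union, mem_seg] at this
          rcases this with h | h
          · exact h
          · exfalso
            simp only at h
            have h4 := h2 r j k hc (by rw [h.1]; exact Finset.mem_insert_self _ _) (by omega)
            rw [h.1] at h4
            exact hu0 (h1 h4)
        refine ⟨h3, fun r j j' h4 h5 h6 => h2 r j j' h4 ?_ h6⟩
        simp [h5]
      · rintro ⟨h1, h2⟩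
        refine ⟨h1.trans Finset.subset_union_left, fun r j j' h4 h5 h6 => h2 r j j' h4 ?_ h6⟩
        rw [Finset.mem_insert, Finset.mem_union, mem_seg] at h5
        rcases h5 with h5 | h5 | h5
        · exfalso
          rw [hu, Prod.mk.injEq] at h5
          exact hF' _ (h1 h4) h5.1
        · exact h5
        · exact (hF' (r, j) (h1 h4) h5.1).elim
    rw [hset]
    refine Finset.sum_congr rfl fun G hG => ?_
    rw [Finset.mem_filter, Finset.mem_powerset] at hG
    rw [← hF, Finset.prod_union]
    · congr 1
      rw [seg, Finset.prod_image (fun a _ b _ h => (Prod.mk.inj h).2)]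
      refine Finset.prod_congr rfl fun j hj => ?_
      have : (i, j) ∉ G := fun h => hF' _ (hG.1 h) rfl
      simp [zw, this]
    · rw [Finset.disjoint_left]
      intro c hc hc'
      exact hF' c hc (mem_seg.mp hc').1

lemma Zs_row (b : ℤ → A) (p : ℤ) (x y : A) (F' : Finset (ℕ × ℕ)) (i l k : ℕ) (hlk : l ≤ k)
    (hF' : ∀ c ∈ F', c.1 ≠ i) :
    (x - y) * Zs b p x y (F' ∪ seg i l k) = Zs b p x y F' *
      (∏ j ∈ Finset.Ico l (k+1), (x - b (p + (j : ℤ) - (i : ℤ))) -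
       ∏ j ∈ Finset.Ico l (k+1), (y - b (p + (j : ℤ) - (i : ℤ)))) := by
  induction k, hlk using Nat.le_induction with
  | base =>
    have : seg i l l = ∅ := by simp [seg]
    rw [this, Finset.union_empty]
    simp
    ring
  | succ k hk ih =>
    rw [Zs_step b p x y F' i l k hk hF', mul_add, ← mul_assoc, ih]
    rw [Finset.prod_Ico_succ_top (show l ≤ k+1 by omega), Finset.prod_Ico_succ_top (show l ≤ k+1 by omega)]
    have e : p + ((k + 1 : ℕ) : ℤ) - i = p + 1 + k - i := by push_cast; ring
    rw [e]
    ring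

/-- row convexity -/
def RowConv (F : Finset (ℕ × ℕ)) : Prop :=
  ∀ i j j' j'', (i, j) ∈ F → (i, j'') ∈ F → j ≤ j' → j' ≤ j'' → (i, j') ∈ F

lemma Zs_symm [IsDomain A] (b : ℤ → A) (p : ℤ) (x y : A) (F : Finset (ℕ × ℕ)) (hF : RowConv F) :
    Zs b p x y F = Zs b p y x F := by
  classical
  by_cases hxy : x = y
  · rw [hxy]
  induction hN : F.card using Nat.strong_induction_on generalizing F with
  | _ N ih =>
    rcases F.eq_empty_or_nonempty with rfl | ⟨⟨i, j0⟩, hc⟩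
    · simp [Zs, zw]
    · set C := (F.filter (fun c => c.1 = i)).image Prod.snd with hC
      have memC : ∀ j, j ∈ C ↔ (i, j) ∈ F := by
        intro j
        simp only [hC, Finset.mem_image, Finset.mem_filter]
        constructor
        · rintro ⟨⟨u, v⟩, ⟨h, rfl⟩, rfl⟩; exact h
        · intro h; exact ⟨_, ⟨h, rfl⟩, rfl⟩
      have hne : C.Nonempty := ⟨j0, (memC _).mpr hc⟩
      set F' := F.filter (fun c => c.1 ≠ i) with hF'
      have hF'i : ∀ c ∈ F', c.1 ≠ i := fun c hc => (Finset.mem_filter.mp hc).2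
      have hdec : F = F' ∪ seg i (C.min' hne) (C.max' hne + 1) := by
        ext ⟨u, v⟩
        rw [Finset.mem_union, mem_seg, hF', Finset.mem_filter]
        constructor
        · intro h
          by_cases hu : u = i
          · right
            subst hu
            refine ⟨rfl, C.min'_le v ((memC v).mpr h), ?_⟩
            have := C.le_max' v ((memC v).mpr h)
            simp only; omega
          · left; exact ⟨h, hu⟩
        · rintro (h | ⟨rfl, h1, h2⟩)
          · exact h.1
          · exact hF _ _ _ _ ((memC _).mp (C.min'_mem hne)) ((memC _).mp (C.max'_mem hne)) h1
              (by simp only at h2; omega)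
      have hlt : F'.card < N := by
        rw [← hN]
        refine Finset.card_lt_card (Finset.filter_ssubset.mpr ⟨_, hc, by simp⟩)
      have hR' : RowConv F' := by
        intro r j j' j'' h1 h2 h3 h4
        rw [hF', Finset.mem_filter] at *
        exact ⟨hF r j j' j'' h1.1 h2.1 h3 h4, h1.2⟩
      have hle : C.min' hne ≤ C.max' hne + 1 := by
        have := C.min'_le_max' hne
        omega
      have e1 := Zs_row b p x y F' i _ _ hle hF'i
      have e2 := Zs_row b p y x F' i _ _ hle hF'i
      rw [← hdec] at e1 e2
      have e3 := ih _ hlt F' hR' rfl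
      have : (x - y) * (Zs b p x y F - Zs b p y x F) = 0 := by
        rw [mul_sub, e1, e3]
        linear_combination e2
      rcases mul_eq_zero.mp this with h | h
      · exact absurd (sub_eq_zero.mp h) hxy
      · exact sub_eq_zero.mp h

end TwoRow


section Sym
variable {A : Type} [CommRing A]

/-- order convexity of a cell set -/
def CConv (s : Finset (ℕ × ℕ)) : Prop :=
  ∀ i j i' j' u v, (i, j) ∈ s → (i', j') ∈ s → i ≤ u → u ≤ i' → j ≤ v → v ≤ j' → (u, v) ∈ s

lemma skew_conv (θi θo : YoungDiagram) : CConv (skewCells θi θo) := by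
  intro i j i' j' u v h1 h2 h3 h4 h5 h6
  simp only [skewCells, Finset.mem_sdiff, YoungDiagram.mem_cells] at *
  exact ⟨θo.up_left_mem h4 h6 h2.1, fun h => h1.2 (θi.up_left_mem h3 h5 h)⟩

/-- total value function -/
def tv {n : ℕ} {s : Finset (ℕ × ℕ)} (T : s → Fin n) (c : ℕ × ℕ) : ℕ :=
  if h : c ∈ s then (T ⟨c, h⟩ : ℕ) else 0

lemma tv_coe {n : ℕ} {s : Finset (ℕ × ℕ)} (T : s → Fin n) (c : s) : tv T c = T c := by
  simp [tv]

lemma ssyt_iff {n : ℕ} {s : Finset (ℕ × ℕ)} (T : s → Fin n) : IsSsyt s T ↔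
    (∀ i j j', (i, j) ∈ s → (i, j') ∈ s → j ≤ j' → tv T (i, j) ≤ tv T (i, j')) ∧
    (∀ i i' j, (i, j) ∈ s → (i', j) ∈ s → i < i' → tv T (i, j) < tv T (i', j)) := by
  constructor
  · intro h
    constructor
    · intro i j j' h1 h2 h3
      have := h.1 ⟨_, h1⟩ ⟨_, h2⟩ rfl h3
      simpa [tv, h1, h2] using this
    · intro i i' j h1 h2 h3
      have := h.2 ⟨_, h1⟩ ⟨_, h2⟩ h3 rfl
      simpa [tv, h1, h2] using this
  · rintro ⟨h1, h2⟩
    constructor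
    · rintro ⟨⟨i, j⟩, hc⟩ ⟨⟨i', j'⟩, hc'⟩ h3 h4
      simp only at h3 h4
      subst h3
      have := h1 _ _ _ hc hc' h4
      simpa [tv, hc, hc'] using this
    · rintro ⟨⟨i, j⟩, hc⟩ ⟨⟨i', j'⟩, hc'⟩ h3 h4
      simp only at h3 h4
      subst h4
      have := h2 _ _ _ hc hc' h3
      simpa [tv, hc, hc'] using this

/-- cell weight -/
def cw {n : ℕ} (b : ℤ → A) (x : Fin n → A) (v : Fin n) (c : ℕ × ℕ) : A :=
  x v - b ((v : ℤ) + 1 + (c.2 : ℤ) - (c.1 : ℤ))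

/-- value in `{p, p+1}` -/
def inpq {n : ℕ} {s : Finset (ℕ × ℕ)} (T : s → Fin n) (p : ℕ) (c : ℕ × ℕ) : Prop :=
  c ∈ s ∧ (tv T c = p ∨ tv T c = p + 1)

/-- free cell -/
def isFree {n : ℕ} {s : Finset (ℕ × ℕ)} (Pre : ℕ × ℕ → Prop) (T : s → Fin n) (p : ℕ)
    (c : ℕ × ℕ) : Prop :=
  ¬ Pre c ∧ inpq T p c ∧ ¬ inpq T p (c.1 + 1, c.2) ∧ ∀ i, c.1 = i + 1 → ¬ inpq T p (i, c.2)

/-- Admissible prefix -/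
def PreOK {n : ℕ} {s : Finset (ℕ × ℕ)} (Pre : ℕ × ℕ → Prop) (T : s → Fin n) (p : ℕ) : Prop :=
  (∀ c, ¬ Pre c) ∨ ∃ c ∈ s, tv T c = p + 1 ∧ ∀ d, Pre d ↔ d = c ∨ ColLT d c

open Classical in
/-- set of free cells -/
noncomputable def freeSet {n : ℕ} {s : Finset (ℕ × ℕ)} (Pre : ℕ × ℕ → Prop) (T : s → Fin n) (p : ℕ) :
    Finset (ℕ × ℕ) := s.filter (isFree Pre T p)

section
variable {n : ℕ} {s : Finset (ℕ × ℕ)} (hs : CConv s) {Pre : ℕ × ℕ → Prop} {T : s → Fin n} {p : ℕ}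
  (hT : IsSsyt s T) (hP : PreOK Pre T p)
include hs hT hP

lemma free_no_pre_right {i k k' : ℕ} (h1 : isFree Pre T p (i, k)) (h2 : (i, k') ∈ s)
    (h3 : Pre (i, k')) (h4 : k < k') (h5 : tv T (i, k') = p) : False := by
  rw [ssyt_iff] at hT
  obtain ⟨hr, hc⟩ := hT
  rcases hP with hP | ⟨⟨ci, cj⟩, hcs, hcq, hP⟩
  · exact hP _ h3
  obtain ⟨f1, ⟨f2, f3⟩, f4, f5⟩ := h1
  rw [hP] at f1 h3
  simp only [ColLT, Prod.mk.injEq, not_or, not_and, not_lt] at f1 h3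
  simp only at f4
  have hkj : k < cj := by
    by_contra hh
    have : k = cj ∧ ci < i := by omega
    obtain ⟨rfl, h⟩ := this
    have := hc ci i k hcs f2 h
    omega
  have hjk : cj ≤ k' := by omega
  have m1 : (i, cj) ∈ s := hs i k i k' i cj f2 h2 le_rfl le_rfl hkj.le hjk
  have v1 := hr i k cj f2 m1 hkj.le
  have v2 := hr i cj k' m1 h2 hjk
  have hci : i < ci := by
    by_contra hh
    rcases Nat.lt_or_ge ci i with h | h
    · have := hc _ _ _ hcs m1 h; omega
    · have : ci = i := by omega
      subst this; omega
  have m2 : (i+1, cj) ∈ s := hs i cj ci cj (i+1) cj m1 hcs (by omega) (by omega) le_rfl le_rfl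
  have v3 : tv T (i+1, cj) ≤ p + 1 := by
    rcases Nat.lt_or_ge (i+1) ci with h | h
    · have := hc _ _ _ m2 hcs h; omega
    · have : ci = i + 1 := by omega
      subst this; omega
  have m3 : (i+1, k) ∈ s := hs i k (i+1) cj (i+1) k f2 m2 (by omega) le_rfl le_rfl hkj.le
  have v4 := hr _ _ _ m3 m2 hkj.le
  have v5 := hc _ _ _ f2 m3 (by omega)
  exact f4 ⟨m3, by omega⟩

omit hs hT in
lemma pre_left {i k k' : ℕ} (h : Pre (i, k)) (h2 : k < k') : Pre (i, k') := by
  rcases hP with hP | ⟨⟨ci, cj⟩, hcs, hcq, hP⟩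
  · exact absurd h (hP _)
  · rw [hP] at *
    simp only [ColLT, Prod.mk.injEq] at *
    omega

omit hs in
lemma pre_col {i i' k : ℕ} (h1 : Pre (i, k)) (h2 : ¬ Pre (i', k)) (h3 : inpq T p (i', k)) : False := by
  rw [ssyt_iff] at hT
  obtain ⟨hr, hc⟩ := hT
  rcases hP with hP | ⟨⟨ci, cj⟩, hcs, hcq, hP⟩
  · exact hP _ h1
  rw [hP] at h1 h2
  simp only [ColLT, Prod.mk.injEq, not_or, not_and, not_lt] at h1 h2
  have : k = cj ∧ ci < i' := by omega
  obtain ⟨rfl, h⟩ := this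
  have := hc ci i' k hcs h3.1 h
  have := h3.2
  omega

/-- The free set is row convex. -/
lemma free_conv : RowConv (freeSet Pre T p) := by
  intro i j j' j'' h1 h2 h3 h4
  rcases eq_or_lt_of_le h4 with rfl | h4'
  · exact h2
  simp only [freeSet, Finset.mem_filter] at *
  obtain ⟨hT1, hT2⟩ := (ssyt_iff T).mp hT
  have m := hs i j i j'' i j' h1.1 h2.1 le_rfl le_rfl h3 h4
  obtain ⟨m1, f1, ⟨-, f2⟩, f3, f4⟩ := h1
  obtain ⟨m2, g1, ⟨-, g2⟩, g3, g4⟩ := h2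
  have v1 := hT1 _ _ _ m1 m h3
  have v2 := hT1 _ _ _ m m2 h4
  refine ⟨m, fun h => g1 (pre_left hP h h4'), ⟨m, by omega⟩, ?_, ?_⟩
  · rintro ⟨q1, q2⟩
    simp only at q1 q2
    have q3 := hs i j (i+1) j' (i+1) j m1 q1 (by omega) le_rfl le_rfl h3
    have w1 := hT1 _ _ _ q3 q1 h3
    have w2 := hT2 _ _ _ m1 q3 (by omega)
    exact f3 ⟨q3, by simp only; omega⟩
  · rintro r hr ⟨q1, q2⟩
    simp only at q1 q2 hr
    subst hr
    have q3 := hs r j' (r+1) j'' r j'' q1 m2 (by omega) (by omega) (by omega) (by omega)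
    have w1 := hT1 _ _ _ q1 q3 h4
    have w2 := hT2 _ _ _ q3 m2 (by omega)
    exact g4 r rfl ⟨q3, by simp only; omega⟩

/-- Changing the values on free cells monotonically preserves semistandardness. -/
lemma free_change (T' : s → Fin n) (h1 : ∀ c ∈ s, ¬ isFree Pre T p c → tv T' c = tv T c)
    (h2 : ∀ c ∈ s, isFree Pre T p c → tv T' c = p ∨ tv T' c = p + 1)
    (h3 : ∀ i j j', isFree Pre T p (i, j) → isFree Pre T p (i, j') → j ≤ j' →
      tv T' (i, j) ≤ tv T' (i, j')) : IsSsyt s T' := by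
  obtain ⟨hT1, hT2⟩ := (ssyt_iff T).mp hT
  rw [ssyt_iff]
  constructor
  · intro i j j' m1 m2 hj
    rcases eq_or_lt_of_le hj with rfl | hj'
    · exact le_rfl
    have v := hT1 _ _ _ m1 m2 hj
    by_cases f1 : isFree Pre T p (i, j) <;> by_cases f2 : isFree Pre T p (i, j')
    · exact h3 _ _ _ f1 f2 hj
    · rw [h1 _ m2 f2]
      have u1 := h2 _ m1 f1
      have u2 := f1.2.1.2
      by_contra hh
      have e1 : tv T (i, j') = p := by omega
      by_cases hpre : Pre (i, j')
      · exact free_no_pre_right hs hT hP f1 m2 hpre hj' e1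
      · apply f2
        refine ⟨hpre, ⟨m2, Or.inl e1⟩, ?_, ?_⟩
        · rintro ⟨q1, q2⟩
          simp only at q1 q2
          have q3 := hs i j (i+1) j' (i+1) j m1 q1 (by omega) le_rfl le_rfl hj
          have w1 := hT1 _ _ _ q3 q1 hj
          have w2 := hT2 _ _ _ m1 q3 (by omega)
          exact f1.2.2.1 ⟨q3, by simp only; omega⟩
        · rintro r hr ⟨q1, q2⟩
          simp only at q1 q2 hr
          subst hr
          have := hT2 _ _ _ q1 m2 (by omega)
          omega
    · rw [h1 _ m1 f1]
      have u1 := h2 _ m2 f2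
      have u2 := f2.2.1.2
      by_contra hh
      have e1 : tv T (i, j) = p + 1 := by omega
      apply f1
      refine ⟨fun h => f2.1 (pre_left hP h hj'), ⟨m1, Or.inr e1⟩, ?_, ?_⟩
      · rintro ⟨q1, q2⟩
        simp only at q1 q2
        have := hT2 _ _ _ m1 q1 (by omega)
        omega
      · rintro r hr ⟨q1, q2⟩
        simp only at q1 q2 hr
        subst hr
        have q3 := hs r j (r+1) j' r j' q1 m2 (by omega) (by omega) (by omega) (by omega)
        have w1 := hT1 _ _ _ q1 q3 hj
        have w2 := hT2 _ _ _ q3 m2 (by omega)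
        exact f2.2.2.2 r rfl ⟨q3, by simp only; omega⟩
    · rw [h1 _ m1 f1, h1 _ m2 f2]; exact v
  · intro i i' j m1 m2 hi
    have v := hT2 _ _ _ m1 m2 hi
    have key : inpq T p (i, j) → inpq T p (i', j) → tv T' (i, j) < tv T' (i', j) := by
      rintro ⟨-, a1⟩ ⟨-, a2⟩
      have m3 := hs i j i' j (i+1) j m1 m2 (by omega) (by omega) le_rfl le_rfl
      have w := hT2 _ _ _ m1 m3 (by omega)
      have hi' : i' = i + 1 := by
        by_contra hh
        have := hT2 _ _ _ m3 m2 (by omega)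
        omega
      subst hi'
      rw [h1 _ m1 (fun f => f.2.2.1 ⟨m2, a2⟩), h1 _ m2 (fun f => f.2.2.2 i rfl ⟨m1, a1⟩)]
      exact v
    by_cases f1 : isFree Pre T p (i, j) <;> by_cases f2 : isFree Pre T p (i', j)
    · exact key f1.2.1 f2.2.1
    · by_cases b2 : inpq T p (i', j)
      · exact key f1.2.1 b2
      · rw [h1 _ m2 f2]
        have := h2 _ m1 f1
        have := f1.2.1.2
        have : ¬ (tv T (i', j) = p ∨ tv T (i', j) = p + 1) := fun h => b2 ⟨m2, h⟩
        omega
    · by_cases b1 : inpq T p (i, j)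
      · exact key b1 f2.2.1
      · rw [h1 _ m1 f1]
        have := h2 _ m2 f2
        have := f2.2.1.2
        have : ¬ (tv T (i, j) = p ∨ tv T (i, j) = p + 1) := fun h => b1 ⟨m1, h⟩
        omega
    · rw [h1 _ m1 f1, h1 _ m2 f2]; exact v

end

/-- Two tableaux in the same collapsed class agree off the free cells. -/
lemma class_agree {n : ℕ} {s : Finset (ℕ × ℕ)} {Pre : ℕ × ℕ → Prop} {T T' : s → Fin n} {p : ℕ}
    (hT : IsSsyt s T) (hT' : IsSsyt s T')
    (hpre : ∀ c ∈ s, Pre c → tv T' c = tv T c)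
    (hcl : ∀ c ∈ s, ¬ (tv T c = p ∨ tv T c = p + 1) → tv T' c = tv T c)
    (hcl' : ∀ c ∈ s, (tv T c = p ∨ tv T c = p + 1) → (tv T' c = p ∨ tv T' c = p + 1)) :
    ∀ c ∈ s, ¬ isFree Pre T p c → tv T' c = tv T c := by
  obtain ⟨hT1, hT2⟩ := (ssyt_iff T).mp hT
  obtain ⟨hT1', hT2'⟩ := (ssyt_iff T').mp hT'
  rintro ⟨i, j⟩ hc hf
  by_cases h1 : Pre (i, j)
  · exact hpre _ hc h1
  by_cases h2 : tv T (i, j) = p ∨ tv T (i, j) = p + 1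
  swap
  · exact hcl _ hc h2
  have h2' := hcl' _ hc h2
  by_contra hne
  apply hf
  refine ⟨h1, ⟨hc, h2⟩, ?_, ?_⟩
  · rintro ⟨q1, q2⟩
    simp only at q1 q2
    have := hcl' _ q1 q2
    have := hT2 _ _ _ hc q1 (by omega)
    have := hT2' _ _ _ hc q1 (by omega)
    omega
  · rintro r hr ⟨q1, q2⟩
    simp only at q1 q2 hr
    subst hr
    have := hcl' _ q1 q2
    have := hT2 _ _ _ q1 hc (by omega)
    have := hT2' _ _ _ q1 hc (by omega)
    omega

end Sym


section Sym2
variable {A : Type} [CommRing A]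

/-- collapse the letter `p+1` to `p`. -/
def collapse {n : ℕ} {s : Finset (ℕ × ℕ)} (P Q : Fin n) (T : s → Fin n) : s → Fin n :=
  fun c => if T c = Q then P else T c

open Classical in
/-- class of a tableau -/
noncomputable def Cls {n : ℕ} {s : Finset (ℕ × ℕ)} (Pre : ℕ × ℕ → Prop) (P Q : Fin n)
    (T1 : s → Fin n) : Finset (s → Fin n) :=
  Finset.univ.filter fun T => IsSsyt s T ∧ (∀ c : s, Pre c → T c = T1 c) ∧
    collapse P Q T = collapse P Q T1

open Classical in
lemma class_sum {n : ℕ} {s : Finset (ℕ × ℕ)} (hs : CConv s) {Pre : ℕ × ℕ → Prop} {T1 : s → Fin n}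
    {P Q : Fin n} (hPQ : (Q : ℕ) = P + 1)
    (hT : IsSsyt s T1) (hP : PreOK Pre T1 P) (b : ℤ → A) (x : Fin n → A) :
    ∑ T ∈ Cls Pre P Q T1, ∏ c ∈ Finset.univ.filter (fun c : s => ¬ Pre c), cw b x (T c) c =
      (∏ c ∈ Finset.univ.filter (fun c : s => ¬ Pre c ∧ ¬ isFree Pre T1 P c), cw b x (T1 c) c) *
      Zs b ((P : ℤ) + 1) (x P) (x Q) (freeSet Pre T1 P) := by
  unfold Zs
  rw [Finset.mul_sum]
  symm
  have hPneQ : P ≠ Q := by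
    intro h; rw [h] at hPQ; omega
  refine Finset.sum_bij (fun G _ => fun c : s =>
    if isFree Pre T1 P c then (if (c : ℕ × ℕ) ∈ G then Q else P) else T1 c) ?_ ?_ ?_ ?_
  · intro G hG
    rw [Finset.mem_filter, Finset.mem_powerset] at hG
    simp only [Cls, Finset.mem_filter, Finset.mem_univ, true_and]
    refine ⟨free_change hs hT hP _ ?_ ?_ ?_, ?_, ?_⟩
    · intro c hc hf
      simp [tv, hc, hf]
    · intro c hc hf
      simp only [tv, hc, hf, dif_pos, if_true]
      split_ifs <;> simp [hPQ]
    · intro i j j' h1 h2 h3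
      have m1 := h1.2.1.1
      have m2 := h2.2.1.1
      simp only [tv, m1, m2, dif_pos, h1, h2, if_true]
      split_ifs with g1 g2 g2
      · exact le_rfl
      · exact absurd (hG.2 i j j' g1 (by simp [freeSet, m2, h2]) h3) g2
      · omega
      · exact le_rfl
    · intro c hc
      have : ¬ isFree Pre T1 P c := fun h => h.1 hc
      simp [this]
    · funext c
      simp only [collapse]
      by_cases hf : isFree Pre T1 P c
      · simp only [hf, if_true]
        have := hf.2.1.2
        rw [tv_coe] at this
        rcases this with h | h
        · have h' : T1 c = P := Fin.ext h
          rw [h', if_neg hPneQ]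
          split_ifs <;> simp_all
        · have h' : T1 c = Q := Fin.ext (h.trans hPQ.symm)
          rw [h', if_pos rfl]
          split_ifs <;> simp_all
      · simp [hf]
  · intro G hG G' hG' h
    rw [Finset.mem_filter, Finset.mem_powerset] at hG hG'
    ext c
    by_cases hc : c ∈ freeSet Pre T1 P
    · have hc' := hc
      rw [freeSet, Finset.mem_filter] at hc'
      have := congrFun h ⟨c, hc'.1⟩
      simp only [hc'.2, if_true] at this
      split_ifs at this with h1 h2 h2 <;> simp_all
    · exact ⟨fun h => absurd (hG.1 h) hc, fun h => absurd (hG'.1 h) hc⟩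
  · intro T hTm
    simp only [Cls, Finset.mem_filter, Finset.mem_univ, true_and] at hTm
    obtain ⟨t1, t2, t3⟩ := hTm
    have hcl' : ∀ c ∈ s, (tv T1 c = P ∨ tv T1 c = P + 1) → (tv T c = P ∨ tv T c = P + 1) := by
      intro c hc h
      have e := congrFun t3 ⟨c, hc⟩
      simp only [tv, hc, dif_pos] at h ⊢
      simp only [collapse] at e
      rw [← hPQ, ← Fin.ext_iff, ← Fin.ext_iff] at *
      rcases h with h | h
      · rw [h, if_neg hPneQ] at e
        split_ifs at e with h2
        · exact Or.inr h2
        · exact Or.inl e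
      · rw [h, if_pos rfl] at e
        split_ifs at e with h2
        · exact Or.inr h2
        · exact Or.inl e
    have hcl : ∀ c ∈ s, ¬ (tv T1 c = P ∨ tv T1 c = P + 1) → tv T c = tv T1 c := by
      intro c hc h
      have e := congrFun t3 ⟨c, hc⟩
      simp only [tv, hc, dif_pos] at h ⊢
      simp only [collapse] at e
      rw [← hPQ, ← Fin.ext_iff, ← Fin.ext_iff] at h
      push Not at h
      rw [if_neg h.2] at e
      split_ifs at e with h2
      · exact absurd e.symm h.1
      · rw [e]
    have hag := class_agree (Pre := Pre) hT t1 (fun c hc hp => by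
      have := t2 ⟨c, hc⟩ hp
      simp [tv, hc, this]) hcl hcl'
    refine ⟨(freeSet Pre T1 P).filter (fun c => tv T c = P + 1), ?_, ?_⟩
    · rw [Finset.mem_filter, Finset.mem_powerset]
      refine ⟨Finset.filter_subset _ _, ?_⟩
      intro i j j' g1 g2 g3
      rw [Finset.mem_filter] at g1 ⊢
      refine ⟨g2, ?_⟩
      have m1 := g1.1
      rw [freeSet, Finset.mem_filter] at m1 g2
      have := hcl' _ g2.1 g2.2.2.1.2
      have := ((ssyt_iff T).mp t1).1 _ _ _ m1.1 g2.1 g3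
      omega
    · funext c
      by_cases hf : isFree Pre T1 P c
      · have hm : (c : ℕ × ℕ) ∈ freeSet Pre T1 P := by simp [freeSet, hf]
        have := hcl' _ c.2 hf.2.1.2
        simp only [hf, if_true, Finset.mem_filter, hm, true_and]
        rw [tv_coe] at *
        split_ifs with h2
        · exact Fin.ext (hPQ.trans h2.symm)
        · exact Fin.ext (by omega)
      · simp only [hf, if_false]
        have := hag c c.2 hf
        rw [tv_coe, tv_coe] at this
        exact (Fin.ext this).symm
  · intro G hG
    rw [← Finset.prod_filter_mul_prod_filter_not (Finset.univ.filter (fun c : s => ¬ Pre c))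
      (fun c : s => isFree Pre T1 P c), Finset.filter_filter, Finset.filter_filter, mul_comm]
    congr 1
    · have e : freeSet Pre T1 P = (Finset.univ.filter
          (fun c : s => ¬ Pre c ∧ isFree Pre T1 P c)).image Subtype.val := by
        ext c
        simp only [freeSet, Finset.mem_filter, Finset.mem_image, Finset.mem_univ, true_and]
        constructor
        · rintro ⟨h1, h2⟩; exact ⟨⟨c, h1⟩, ⟨h2.1, h2⟩, rfl⟩
        · rintro ⟨c, h, rfl⟩; exact ⟨c.2, h.2⟩
      rw [e, Finset.prod_image (fun a _ b _ h => Subtype.ext h)]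
      refine Finset.prod_congr rfl fun c hc => ?_
      simp only [Finset.mem_filter, Finset.mem_univ, true_and] at hc
      simp only [hc.2, if_true, zw, cw]
      split_ifs
      · rw [hPQ]; push_cast; rfl
      · rfl
    · refine Finset.prod_congr rfl fun c hc => ?_
      simp only [Finset.mem_filter, Finset.mem_univ, true_and] at hc
      simp [hc.2]

open Classical in
lemma paired_symm {n : ℕ} {s : Finset (ℕ × ℕ)} {Pre : ℕ × ℕ → Prop} {T1 : s → Fin n}
    {P Q : Fin n} (hPQ : (Q : ℕ) = P + 1)
    (hT : IsSsyt s T1) (hP : PreOK Pre T1 P) (b : ℤ → A) (x : Fin n → A) :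
    (∏ c ∈ Finset.univ.filter (fun c : s => ¬ Pre c ∧ ¬ isFree Pre T1 P c),
      cw b (x ∘ Equiv.swap P Q) (T1 c) c) =
    (∏ c ∈ Finset.univ.filter (fun c : s => ¬ Pre c ∧ ¬ isFree Pre T1 P c), cw b x (T1 c) c) := by
  have hPneQ : P ≠ Q := by
    intro h; rw [h] at hPQ; omega
  obtain ⟨hT1, hT2⟩ := (ssyt_iff T1).mp hT
  set N := Finset.univ.filter (fun c : s => ¬ Pre c ∧ ¬ isFree Pre T1 P c) with hN
  set U := N.filter (fun c => T1 c = P) with hU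
  set W := N.filter (fun c => T1 c = Q) with hW
  set R := N.filter (fun c => T1 c ≠ P ∧ T1 c ≠ Q) with hR
  have split : ∀ f : s → A, ∏ c ∈ N, f c = (∏ c ∈ U, f c) * (∏ c ∈ W, f c) * ∏ c ∈ R, f c := by
    intro f
    have eW : (N.filter (fun c => ¬ T1 c = P)).filter (fun c => T1 c = Q) = W := by
      ext c
      simp only [hW, Finset.mem_filter]
      constructor
      · rintro ⟨⟨h1, h2⟩, h3⟩; exact ⟨h1, h3⟩
      · rintro ⟨h1, h2⟩; exact ⟨⟨h1, by rw [h2]; exact hPneQ.symm⟩, h2⟩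
    have eR : (N.filter (fun c => ¬ T1 c = P)).filter (fun c => ¬ T1 c = Q) = R := by
      ext c
      simp only [hR, Finset.mem_filter, and_assoc, ne_eq]
    rw [← Finset.prod_filter_mul_prod_filter_not N (fun c => T1 c = P),
      ← Finset.prod_filter_mul_prod_filter_not (N.filter (fun c => ¬ T1 c = P)) (fun c => T1 c = Q),
      eW, eR, ← mul_assoc]
  have hpair : ∀ f : s → A, ∀ g : ℕ × ℕ → A, (∀ c ∈ W, ∀ i, (c : ℕ × ℕ).1 = i + 1 → f c = g (i, (c : ℕ × ℕ).2)) →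
      ∏ c ∈ W, f c = ∏ c ∈ U, g c := by
    intro f g hfg
    symm
    have hbelow : ∀ c ∈ U, ∃ h : ((c : ℕ × ℕ).1 + 1, (c : ℕ × ℕ).2) ∈ s, (⟨_, h⟩ : s) ∈ W := by
      rintro ⟨⟨i, j⟩, hc⟩ hcU
      simp only [hU, hN, Finset.mem_filter, Finset.mem_univ, true_and] at hcU
      obtain ⟨⟨c1, c2⟩, c3⟩ := hcU
      have c4 : tv T1 (i, j) = P := by simp [tv, hc, c3]
      have hin : inpq T1 P (i, j) := ⟨hc, Or.inl c4⟩
      have hb : inpq T1 P (i+1, j) := by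
        by_contra hb
        apply c2
        refine ⟨c1, hin, hb, ?_⟩
        rintro r hr ⟨q1, q2⟩
        simp only at hr q1 q2
        subst hr
        have := hT2 _ _ _ q1 hc (by omega)
        omega
      refine ⟨hb.1, ?_⟩
      simp only [hW, hN, Finset.mem_filter, Finset.mem_univ, true_and]
      refine ⟨⟨fun h => pre_col hT hP h c1 hin, fun h => h.2.2.2 i rfl hin⟩, ?_⟩
      have v := hT2 _ _ _ hc hb.1 (by omega)
      have h5 := hb.2
      simp only [tv, hc, hb.1, dif_pos] at v h5 c4
      exact Fin.ext (by omega)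
    refine Finset.prod_bij (fun c hc => ⟨_, (hbelow c hc).1⟩) ?_ ?_ ?_ ?_
    · intro c hc; exact (hbelow c hc).2
    · intro c hc c' hc' h
      have := congrArg Subtype.val h
      simp only [Prod.mk.injEq, add_left_inj] at this
      exact Subtype.ext (Prod.ext this.1 this.2)
    · rintro ⟨⟨i, j⟩, hc⟩ hcW
      have hcW' := hcW
      simp only [hW, hN, Finset.mem_filter, Finset.mem_univ, true_and] at hcW
      obtain ⟨⟨c1, c2⟩, c3⟩ := hcW
      have c4 : tv T1 (i, j) = P + 1 := by simp [tv, hc, c3, hPQ]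
      have hin : inpq T1 P (i, j) := ⟨hc, Or.inr c4⟩
      have hb : ∃ r, i = r + 1 ∧ inpq T1 P (r, j) := by
        by_contra hb
        push Not at hb
        apply c2
        refine ⟨c1, hin, ?_, fun r hr => hb r hr⟩
        rintro ⟨q1, q2⟩
        simp only at q1 q2
        have := hT2 _ _ _ hc q1 (by omega)
        omega
      obtain ⟨r, rfl, hb⟩ := hb
      refine ⟨⟨(r, j), hb.1⟩, ?_, rfl⟩
      simp only [hU, hN, Finset.mem_filter, Finset.mem_univ, true_and]
      refine ⟨⟨fun h => pre_col hT hP h c1 hin, fun h => h.2.2.1 hin⟩, ?_⟩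
      have v := hT2 _ _ _ hb.1 hc (by omega)
      have h5 := hb.2
      simp only [tv, hc, hb.1, dif_pos] at v h5 c4
      exact Fin.ext (by omega)
    · intro c hc
      exact (hfg _ (hbelow c hc).2 _ rfl).symm
  rw [split, split]
  congr 1
  · rw [hpair _ (fun c => x P - b ((P : ℤ) + 1 + (c.2 : ℤ) - (c.1 : ℤ))),
      hpair (fun c => cw b x (T1 c) c) (fun c => x Q - b ((P : ℤ) + 1 + (c.2 : ℤ) - (c.1 : ℤ))), mul_comm]
    · congr 1
      · refine Finset.prod_congr rfl fun c hc => ?_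
        rw [hU, Finset.mem_filter] at hc
        simp [cw, hc.2]
      · refine Finset.prod_congr rfl fun c hc => ?_
        rw [hU, Finset.mem_filter] at hc
        simp [cw, hc.2]
    · intro c hc i hi
      rw [hW, Finset.mem_filter] at hc
      simp only [cw, hc.2, hi, hPQ]
      congr 2
      push_cast; ring
    · intro c hc i hi
      rw [hW, Finset.mem_filter] at hc
      simp only [cw, hc.2, hi, hPQ, Function.comp, Equiv.swap_apply_right]
      congr 2
      push_cast; ring
  · refine Finset.prod_congr rfl fun c hc => ?_
    rw [hR, Finset.mem_filter] at hc
    simp [cw, Equiv.swap_apply_of_ne_of_ne hc.2.1 hc.2.2]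

open Classical in
/-- Symmetry of the partial tableau sums. -/
theorem sym_swap [IsDomain A] {n : ℕ} {s : Finset (ℕ × ℕ)} (hs : CConv s) {Pre : ℕ × ℕ → Prop} {T0 : s → Fin n}
    {P Q : Fin n} (hPQ : (Q : ℕ) = P + 1) (hP : PreOK Pre T0 P) (b : ℤ → A) (x : Fin n → A) :
    ∑ T ∈ Finset.univ.filter (fun T : s → Fin n => IsSsyt s T ∧ ∀ c : s, Pre c → T c = T0 c),
      ∏ c ∈ Finset.univ.filter (fun c : s => ¬ Pre c), cw b (x ∘ Equiv.swap P Q) (T c) c =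
    ∑ T ∈ Finset.univ.filter (fun T : s → Fin n => IsSsyt s T ∧ ∀ c : s, Pre c → T c = T0 c),
      ∏ c ∈ Finset.univ.filter (fun c : s => ¬ Pre c), cw b x (T c) c := by
  rw [← Finset.sum_fiberwise _ (collapse P Q), ← Finset.sum_fiberwise (g := collapse P Q)
    (f := fun T : s → Fin n => ∏ c ∈ Finset.univ.filter (fun c : s => ¬ Pre c), cw b x (T c) c)]
  refine Finset.sum_congr rfl fun K _ => ?_
  rw [Finset.filter_filter]
  by_cases hK : ∃ T1 : s → Fin n, (IsSsyt s T1 ∧ ∀ c : s, Pre c → T1 c = T0 c) ∧ collapse P Q T1 = K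
  · obtain ⟨T1, ⟨h1, h2⟩, rfl⟩ := hK
    have e : Finset.univ.filter (fun T : s → Fin n => (IsSsyt s T ∧ ∀ c : s, Pre c → T c = T0 c) ∧
        collapse P Q T = collapse P Q T1) = Cls Pre P Q T1 := by
      ext T
      simp only [Cls, Finset.mem_filter, Finset.mem_univ, true_and, and_assoc]
      constructor
      · rintro ⟨h3, h4, h5⟩; exact ⟨h3, fun c hc => (h4 c hc).trans (h2 c hc).symm, h5⟩
      · rintro ⟨h3, h4, h5⟩; exact ⟨h3, fun c hc => (h4 c hc).trans (h2 c hc), h5⟩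
    have hP1 : PreOK Pre T1 P := by
      rcases hP with h | ⟨c, hc, h3, h4⟩
      · exact Or.inl h
      · refine Or.inr ⟨c, hc, ?_, h4⟩
        rw [← h3]
        have := h2 ⟨c, hc⟩ ((h4 c).mpr (Or.inl rfl))
        simp [tv, hc, this]
    rw [e, class_sum hs hPQ h1 hP1, class_sum hs hPQ h1 hP1, paired_symm hPQ h1 hP1]
    simp only [Function.comp, Equiv.swap_apply_left, Equiv.swap_apply_right]
    rw [Zs_symm _ _ _ _ _ (free_conv hs h1 hP1)]
  · rw [Finset.filter_false_of_mem]
    · simp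
    · intro T _ h
      exact hK ⟨T, h⟩

end Sym2



section AltSec
variable {A : Type} [CommRing A] {n : ℕ}

/-- Antisymmetrisation. -/
def Alt (g : (Fin n → A) → A) (x : Fin n → A) : A :=
  ∑ σ : Equiv.Perm (Fin n), ((Equiv.Perm.sign σ : ℤ) : A) * g (x ∘ σ)

lemma Alt_sum {ι : Type*} (S : Finset ι) (g : ι → (Fin n → A) → A) (x : Fin n → A) :
    Alt (fun y => ∑ i ∈ S, g i y) x = ∑ i ∈ S, Alt (g i) x := by
  simp only [Alt, Finset.mul_sum]
  rw [Finset.sum_comm]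

lemma Alt_add (g h : (Fin n → A) → A) (x : Fin n → A) :
    Alt (fun y => g y + h y) x = Alt g x + Alt h x := by
  simp only [Alt, mul_add, Finset.sum_add_distrib]

lemma Alt_smul (t : A) (g : (Fin n → A) → A) (x : Fin n → A) :
    Alt (fun y => t * g y) x = t * Alt g x := by
  simp only [Alt, Finset.mul_sum]
  exact Finset.sum_congr rfl fun _ _ => by ring

lemma Alt_mul_symm (f g : (Fin n → A) → A) (hf : ∀ y (σ : Equiv.Perm (Fin n)), f (y ∘ σ) = f y)
    (x : Fin n → A) : Alt (fun y => f y * g y) x = f x * Alt g x := by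
  simp only [Alt, Finset.mul_sum, hf]
  exact Finset.sum_congr rfl fun _ _ => by ring

lemma Alt_eq_zero (g : (Fin n → A) → A) {P Q : Fin n} (hPQ : P ≠ Q)
    (h : ∀ y, g (y ∘ Equiv.swap P Q) = g y) (x : Fin n → A) : Alt g x = 0 := by
  refine Finset.sum_involution (fun σ _ => σ * Equiv.swap P Q) ?_ ?_ ?_ ?_
  · intro σ _
    have e : x ∘ (σ * Equiv.swap P Q : Equiv.Perm (Fin n)) = (x ∘ σ) ∘ Equiv.swap P Q := by
      ext i; simp [Function.comp]
    rw [e, h]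
    simp [Equiv.Perm.sign_swap hPQ]
  · intro σ _ _ h
    have : Equiv.swap P Q = 1 := by simpa using h
    exact hPQ (by simpa using (Equiv.swap_eq_one_iff.mp this))
  · intro σ _; exact Finset.mem_univ _
  · intro σ _; simp [mul_assoc]

/-- Product of shifted powers. -/
def ek (a : ℤ → A) (k : Fin n → ℕ) (y : Fin n → A) : A := ∏ r, pw a (y r) (k r)

lemma Dd_eq_Alt (a : ℤ → A) (l : Fin n → ℕ) (x : Fin n → A) :
    Dd a n (kap _ l) (fun i => x i.rev) = Alt (ek a (fun r => l r + (n - 1 - r))) x := by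
  have e : (Matrix.of fun i j : Fin n => pw a (x j.rev) (kap _ l i)) =
      ((Matrix.of fun i j : Fin n => pw a (x i) (l j + (n - 1 - j))).transpose).submatrix
        Fin.revPerm Fin.revPerm := by
    ext i j
    simp only [Matrix.of_apply, kap, Matrix.submatrix_apply, Matrix.transpose_apply, Fin.revPerm_apply]
    congr 2
    simp [Fin.val_rev]; omega
  rw [Dd, e, Matrix.det_submatrix_equiv_self, Matrix.det_transpose, Matrix.det_apply']
  simp only [Alt, ek, Matrix.of_apply, Function.comp]

open Classical in
lemma sgen_symm [IsDomain A] {s : Finset (ℕ × ℕ)} (hs : CConv s) (b : ℤ → A) (y : Fin n → A)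
    (σ : Equiv.Perm (Fin n)) : sgen n s (y ∘ σ) b = sgen n s y b := by
  have key : ∀ (P Q : Fin n), (Q : ℕ) = P + 1 → ∀ y : Fin n → A,
      sgen n s (y ∘ Equiv.swap P Q) b = sgen n s y b := by
    intro P Q hPQ y
    by_cases hT : Nonempty (s → Fin n)
    · obtain ⟨T0⟩ := hT
      have := sym_swap (Pre := fun _ => False) (T0 := T0) hs hPQ (Or.inl fun _ h => h) b y
      simp only [sgen_eq]
      simpa [cw] using this
    · rw [not_nonempty_iff] at hT
      simp only [sgen_eq]
      simp
  obtain _ | m := n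
  · congr 1; ext i; exact i.elim0
  have hσ : σ ∈ (⊤ : Submonoid (Equiv.Perm (Fin (m+1)))) := trivial
  rw [← Equiv.Perm.mclosure_swap_castSucc_succ] at hσ
  induction hσ using Submonoid.closure_induction generalizing y with
  | mem τ h =>
    obtain ⟨i, rfl⟩ := h
    exact key _ _ (by simp) y
  | one => rfl
  | mul τ ρ _ _ h1 h2 =>
    have e : y ∘ (τ * ρ : Equiv.Perm (Fin (m+1))) = (y ∘ τ) ∘ ρ := by ext i; simp [Function.comp]
    rw [e, h2, h1]

/-- Recursive expansion. -/
noncomputable def PP {α : Type} (a : ℤ → A) (x : Fin n → A) (T : α → Fin n) (β : α → A) :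
    List α → (Fin n → ℕ) → A
  | [], k => Alt (ek a k) x
  | c :: w, k => (open Classical in if StrictAnti (k + Pi.single (T c) 1) then
      PP a x T β w (k + Pi.single (T c) 1) else 0) +
      (a (k (T c) + 1) - β c) * PP a x T β w k

lemma ek_step (a : ℤ → A) (k : Fin n → ℕ) (y : Fin n → A) (r : Fin n) (β : A) :
    (y r - β) * ek a k y = ek a (k + Pi.single r 1) y + (a (k r + 1) - β) * ek a k y := by
  have e : ek a (k + Pi.single r 1) y = (y r - a (k r + 1)) * ek a k y := by
    simp only [ek]
    rw [← Finset.mul_prod_erase _ _ (Finset.mem_univ r), ← Finset.mul_prod_erase _ (fun r => pw a (y r) (k r)) (Finset.mem_univ r)]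
    have : ∏ i ∈ Finset.univ.erase r, pw a (y i) ((k + Pi.single r 1 : Fin n → ℕ) i) =
        ∏ i ∈ Finset.univ.erase r, pw a (y i) (k i) := by
      refine Finset.prod_congr rfl fun i hi => ?_
      simp [Finset.ne_of_mem_erase hi]
    rw [this]
    simp only [Pi.add_apply, Pi.single_eq_same, pw_succ]
    ring
  rw [e]; ring

lemma not_anti {k : Fin n → ℕ} (hk : StrictAnti k) {r : Fin n}
    (h : ¬ StrictAnti (k + Pi.single r 1)) :
    ∃ P : Fin n, (r : ℕ) = P + 1 ∧ k P = k r + 1 := by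
  by_contra hc
  push Not at hc
  apply h
  intro i j hij
  have h1 := hk hij
  simp only [Pi.add_apply]
  by_cases hj : j = r
  · subst hj
    have hi : i ≠ j := hij.ne
    simp only [Pi.single_eq_same, Pi.single_eq_of_ne hi]
    by_cases hi' : (j : ℕ) = i + 1
    · have := hc i hi'; omega
    · have hlt : (i : ℕ) < j := hij
      have q : (i : ℕ) + 1 < n := by omega
      have h2 := hk (show i < (⟨i + 1, q⟩ : Fin n) from Fin.lt_def.mpr (by simp))
      have h3 := hk (show (⟨i + 1, q⟩ : Fin n) < j from Fin.lt_def.mpr (by simp; omega))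
      omega
  · simp only [Pi.single_eq_of_ne hj]; omega

open Classical in
lemma cancel [IsDomain A] {s : Finset (ℕ × ℕ)} (hs : CConv s) (a b : ℤ → A) (x : Fin n → A) :
    ∀ (w : List s), w.Pairwise (fun c d : s => ColLT c d) →
      (∀ d, d ∉ w → ∀ c ∈ w, ColLT (d : ℕ × ℕ) c) →
      ∀ (T0 : s → Fin n) (k : Fin n → ℕ), StrictAnti k →
      ∑ T ∈ Finset.univ.filter (fun T : s → Fin n => IsSsyt s T ∧ ∀ c : s, c ∉ w → T c = T0 c),
        Alt (fun y => (w.map fun c => cw b y (T c) c).prod * ek a k y) x =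
      ∑ T ∈ Finset.univ.filter (fun T : s → Fin n => IsSsyt s T ∧ ∀ c : s, c ∉ w → T c = T0 c),
        PP a x T (fun c => b ((T c : ℤ) + 1 + ((c : ℕ × ℕ).2 : ℤ) - ((c : ℕ × ℕ).1 : ℤ))) w k := by
  intro w
  induction w with
  | nil => intro _ _ T0 k _; simp [PP]
  | cons c w ih =>
    intro hw hd T0 k hk
    rw [List.pairwise_cons] at hw
    obtain ⟨hcw, hw⟩ := hw
    have hirr : ∀ e : ℕ × ℕ, ¬ ColLT e e := by intro e h; simp [ColLT] at h
    have hcnw : c ∉ w := fun h => hirr _ (hcw c h)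
    have hd' : ∀ d, d ∉ w → ∀ e ∈ w, ColLT (d : ℕ × ℕ) e := by
      intro d hdw e he
      by_cases h : d = c
      · subst h; exact hcw e he
      · exact hd d (by simp [h, hdw]) e (by simp [he])
    rw [← Finset.sum_fiberwise _ (fun T => T c), ← Finset.sum_fiberwise (g := fun T => T c)
      (f := fun T : s → Fin n => PP a x T (fun c : s => b ((T c : ℤ) + 1 + ((c : ℕ × ℕ).2 : ℤ) - ((c : ℕ × ℕ).1 : ℤ))) (c :: w) k)]
    refine Finset.sum_congr rfl fun r _ => ?_
    have eF : (Finset.univ.filter (fun T : s → Fin n => IsSsyt s T ∧ ∀ d : s, d ∉ c :: w → T d = T0 d)).filter (fun T => T c = r) =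
        Finset.univ.filter (fun T : s → Fin n => IsSsyt s T ∧ ∀ d : s, d ∉ w → T d = Function.update T0 c r d) := by
      ext T
      simp only [Finset.mem_filter, Finset.mem_univ, true_and, and_assoc]
      refine and_congr_right fun _ => ?_
      constructor
      · rintro ⟨h1, h2⟩ d hdw
        by_cases h : d = c
        · subst h; simp [h2]
        · simp [h, h1 d (by simp [h, hdw])]
      · intro h
        refine ⟨fun d hdw => ?_, by simpa using h c hcnw⟩
        simp only [List.mem_cons, not_or] at hdw
        simpa [hdw.1] using h d hdw.2
    rw [eF]
    set F := Finset.univ.filter (fun T : s → Fin n => IsSsyt s T ∧ ∀ d : s, d ∉ w → T d = Function.update T0 c r d) with hF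
    have hTc : ∀ T ∈ F, T c = r := by
      intro T hT
      simp only [hF, Finset.mem_filter] at hT
      simpa using hT.2.2 c hcnw
    have e1 : ∀ T ∈ F, Alt (fun y => ((c :: w).map fun c => cw b y (T c) c).prod * ek a k y) x =
        Alt (fun y => (w.map fun c => cw b y (T c) c).prod * ek a (k + Pi.single r 1) y) x +
        (a (k r + 1) - b ((r : ℤ) + 1 + ((c : ℕ × ℕ).2 : ℤ) - ((c : ℕ × ℕ).1 : ℤ))) *
        Alt (fun y => (w.map fun c => cw b y (T c) c).prod * ek a k y) x := by
      intro T hT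
      rw [← Alt_smul, ← Alt_add]
      congr 1
      ext y
      have := ek_step a k y r (b ((r : ℤ) + 1 + ((c : ℕ × ℕ).2 : ℤ) - ((c : ℕ × ℕ).1 : ℤ)))
      simp only [List.map_cons, List.prod_cons, hTc T hT]
      rw [mul_right_comm, show cw b y r c = y r - b ((r : ℤ) + 1 + ((c : ℕ × ℕ).2 : ℤ) - ((c : ℕ × ℕ).1 : ℤ)) from rfl, this]
      ring
    rw [Finset.sum_congr rfl e1, Finset.sum_add_distrib, ← Finset.mul_sum, ih hw hd' _ k hk]
    have e2 : ∀ T ∈ F, PP a x T (fun c => b ((T c : ℤ) + 1 + ((c : ℕ × ℕ).2 : ℤ) - ((c : ℕ × ℕ).1 : ℤ))) (c :: w) k =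
        (if StrictAnti (k + Pi.single r 1) then PP a x T (fun c => b ((T c : ℤ) + 1 + ((c : ℕ × ℕ).2 : ℤ) - ((c : ℕ × ℕ).1 : ℤ))) w (k + Pi.single r 1) else 0) +
        (a (k r + 1) - b ((r : ℤ) + 1 + ((c : ℕ × ℕ).2 : ℤ) - ((c : ℕ × ℕ).1 : ℤ))) *
          PP a x T (fun c => b ((T c : ℤ) + 1 + ((c : ℕ × ℕ).2 : ℤ) - ((c : ℕ × ℕ).1 : ℤ))) w k := by
      intro T hT
      simp only [PP, hTc T hT]
    rw [Finset.sum_congr rfl e2, Finset.sum_add_distrib, ← Finset.mul_sum]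
    congr 1
    by_cases hs' : StrictAnti (k + Pi.single r 1)
    · simp only [hs', if_true]
      exact ih hw hd' _ _ hs'
    · simp only [hs', if_false, Finset.sum_const_zero]
      obtain ⟨P, hP1, hP2⟩ := not_anti hk hs'
      rw [← Alt_sum]
      have hPr : P ≠ r := by intro h; rw [h] at hP1; omega
      refine Alt_eq_zero _ hPr (fun y => ?_) x
      rw [← Finset.sum_mul, ← Finset.sum_mul]
      congr 1
      · have hPre : ∀ d : s, d ∉ w ↔ ((d : ℕ × ℕ) = c ∨ ColLT (d : ℕ × ℕ) c) := by
          intro d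
          constructor
          · intro h
            by_cases h' : d = c
            · left; rw [h']
            · right; exact hd d (by simp [h, h']) c (by simp)
          · rintro (h | h) h'
            · rw [Subtype.ext h] at h'; exact hcnw h'
            · have := hcw d h'
              simp only [ColLT] at this h
              omega
        have hS := sym_swap (Pre := fun d => d = c ∨ ColLT d c) (T0 := Function.update T0 c r) hs hP1
          (Or.inr ⟨c, c.2, by simp [tv, hP1], fun d => Iff.rfl⟩) b y
        have eW : ∀ (T : s → Fin n) (y : Fin n → A), (w.map fun c => cw b y (T c) c).prod =
            ∏ d ∈ Finset.univ.filter (fun d : s => ¬ ((d : ℕ × ℕ) = c ∨ ColLT (d : ℕ × ℕ) c)), cw b y (T d) d := by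
          intro T y
          have nd : w.Nodup := List.Pairwise.imp (fun {u v} h => by rintro rfl; exact hirr _ h) hw
          rw [← List.prod_toFinset _ nd]
          refine Finset.prod_congr ?_ fun _ _ => rfl
          ext d
          simp only [List.mem_toFinset, Finset.mem_filter, Finset.mem_univ, true_and, ← hPre, not_not]
        simp only [eW, hF, hPre]
        convert hS
      · simp only [ek]
        rw [← Equiv.prod_comp (Equiv.swap P r) (fun r' => pw a (y r') _)]
        refine Finset.prod_congr rfl fun i _ => ?_
        simp only [Function.comp]
        congr 1
        have h1 : (k + Pi.single r 1 : Fin n → ℕ) P = k r + 1 := by simp [hPr, hP2]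
        have h2 : (k + Pi.single r 1 : Fin n → ℕ) r = k r + 1 := by simp
        by_cases hi : i = P
        · subst hi; rw [Equiv.swap_apply_left, h1, h2]
        · by_cases hi' : i = r
          · subst hi'; rw [Equiv.swap_apply_right, h1, h2]
          · rw [Equiv.swap_apply_of_ne_of_ne hi hi']

end AltSec


section Unroll
variable {A : Type} [CommRing A] {n : ℕ} {s : Finset (ℕ × ℕ)}

lemma ColLT_irrefl (c : ℕ × ℕ) : ¬ ColLT c c := by simp [ColLT]

lemma ColLT_trans {c d e : ℕ × ℕ} (h : ColLT c d) (h' : ColLT d e) : ColLT c e := by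
  simp only [ColLT] at *; omega

lemma ColLT_asymm {c d : ℕ × ℕ} (h : ColLT c d) : ¬ ColLT d c := by
  simp only [ColLT] at *; omega

lemma ColLT_total {c d : ℕ × ℕ} (h : c ≠ d) : ColLT c d ∨ ColLT d c := by
  obtain ⟨c1, c2⟩ := c
  obtain ⟨d1, d2⟩ := d
  simp only [ColLT, ne_eq, Prod.mk.injEq] at *; omega

lemma enum (B : Finset s) (m : ℕ) (hm : B.card = m) :
    ∃ β : Fin m → s, (∀ i j, i < j → ColLT (β i : ℕ × ℕ) (β j)) ∧ ∀ c, c ∈ B ↔ ∃ i, β i = c := by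
  let key : s → ℕᵒᵈ ×ₗ ℕ := fun c => toLex (OrderDual.toDual (c : ℕ × ℕ).2, (c : ℕ × ℕ).1)
  have hkey : Function.Injective key := by
    intro c d h
    have h1 := congrArg (fun z => (ofLex z).1) h
    have h2 := congrArg (fun z => (ofLex z).2) h
    exact Subtype.ext (Prod.ext h2 h1)
  have hlt : ∀ c d : s, key c < key d → ColLT (c : ℕ × ℕ) d := by
    intro c d h'
    rw [Prod.Lex.lt_iff] at h'
    rcases h' with h' | ⟨h1, h2⟩
    · left; exact h'
    · right; exact ⟨h1, h2⟩
  have hm' : (B.image key).card = m := by rw [Finset.card_image_of_injective _ hkey, hm]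
  have hex : ∀ i : Fin m, ∃ c ∈ B, key c = (B.image key).orderEmbOfFin hm' i := fun i =>
    Finset.mem_image.mp (Finset.orderEmbOfFin_mem (B.image key) hm' i)
  choose β hβ1 hβ2 using hex
  refine ⟨β, fun i j h => hlt _ _ ?_, fun c => ⟨fun hc => ?_, ?_⟩⟩
  · rw [hβ2, hβ2]; exact ((B.image key).orderEmbOfFin hm').strictMono h
  · have h1 := Finset.range_orderEmbOfFin (B.image key) hm'
    have h2 : key c ∈ Set.range ((B.image key).orderEmbOfFin hm') := by
      rw [h1]; exact Finset.mem_coe.mpr (Finset.mem_image_of_mem _ hc)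
    obtain ⟨i, hi⟩ := h2
    exact ⟨i, hkey ((hβ2 i).trans hi)⟩
  · rintro ⟨i, rfl⟩; exact hβ1 i

/-- content of a filling restricted to a set of cells -/
def cnt (T : s → Fin n) (B : Finset s) : Fin n → ℕ := fun r => (B.filter (fun c => T c = r)).card

/-- barred cells before `c` -/
def bef (B : Finset s) (c : s) : Finset s := B.filter (fun γ => ColLT (γ : ℕ × ℕ) c)

/-- barred cells weakly before `c` -/
def befe (B : Finset s) (c : s) : Finset s := B.filter (fun γ => ¬ ColLT (c : ℕ × ℕ) γ)

/-- admissible sets of barred cells -/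
def Adm (T : s → Fin n) (k : Fin n → ℕ) (B : Finset s) : Prop :=
  ∀ c ∈ B, StrictAnti (k + cnt T (befe B c))

lemma cnt_insert (T : s → Fin n) {B : Finset s} {c : s} (hc : c ∉ B) :
    cnt T (insert c B) = Pi.single (T c) 1 + cnt T B := by
  ext r
  simp only [cnt, Pi.add_apply, Finset.filter_insert]
  by_cases h : T c = r
  · subst h
    rw [if_pos rfl, Finset.card_insert_of_notMem (by simp [hc])]
    simp; omega
  · rw [if_neg h, Pi.single_eq_of_ne (Ne.symm h)]; simp

@[simp] lemma cnt_empty (T : s → Fin n) : cnt T ∅ = 0 := by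
  ext r; simp [cnt]

open Classical in
lemma unroll (a : ℤ → A) (x : Fin n → A) (T : s → Fin n) (β : s → A) :
    ∀ w : List s, w.Pairwise (fun c d : s => ColLT c d) → ∀ k : Fin n → ℕ,
    PP a x T β w k = ∑ B ∈ w.toFinset.powerset,
      if Adm T k B then
        (∏ c ∈ w.toFinset \ B, (a ((k (T c) : ℤ) + (cnt T (bef B c) (T c) : ℕ) + 1) - β c)) *
          Alt (ek a (k + cnt T B)) x else 0 := by
  intro w
  induction w with
  | nil => intro _ k; simp [PP, Adm]
  | cons c w ih =>
    intro hw k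
    rw [List.pairwise_cons] at hw
    obtain ⟨hcw, hw⟩ := hw
    have hcnw : c ∉ w.toFinset := fun h => ColLT_irrefl _ (hcw c (by simpa using h))
    rw [List.toFinset_cons, Finset.sum_powerset_insert hcnw, PP, add_comm]
    congr 1
    · rw [ih hw, Finset.mul_sum]
      refine Finset.sum_congr rfl fun B hB => ?_
      rw [Finset.mem_powerset] at hB
      split_ifs with hA
      · have hcB : c ∉ B := fun h => hcnw (hB h)
        rw [Finset.insert_sdiff_of_notMem _ hcB, Finset.prod_insert (by simp [hcnw])]
        have : bef B c = ∅ := by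
          rw [bef, Finset.filter_eq_empty_iff]
          intro d hd h
          exact ColLT_asymm h (hcw d (by simpa using hB hd))
        rw [this]
        simp [mul_assoc]
      · simp
    · have hAdm : ∀ B ⊆ w.toFinset, (Adm T k (insert c B) ↔ StrictAnti (k + Pi.single (T c) 1) ∧
          Adm T (k + Pi.single (T c) 1) B) := by
        intro B hB
        have hcB : c ∉ B := fun h => hcnw (hB h)
        have h1 : befe (insert c B) c = {c} := by
          ext d
          simp only [befe, Finset.mem_filter, Finset.mem_insert, Finset.mem_singleton]
          constructor
          · rintro ⟨h | h, h2⟩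
            · exact h
            · exact (h2 (hcw d (by simpa using hB h))).elim
          · rintro rfl; exact ⟨Or.inl rfl, ColLT_irrefl _⟩
        have h2 : ∀ d ∈ B, befe (insert c B) d = insert c (befe B d) := by
          intro d hd
          ext e
          simp only [befe, Finset.mem_filter, Finset.mem_insert]
          constructor
          · rintro ⟨h | h, h2⟩
            · exact Or.inl h
            · exact Or.inr ⟨h, h2⟩
          · rintro (rfl | h)
            · exact ⟨Or.inl rfl, ColLT_asymm (hcw d (by simpa using hB hd))⟩
            · exact ⟨Or.inr h.1, h.2⟩
        have h3 : ∀ d, c ∉ befe B d := fun d h => hcB (Finset.mem_filter.mp h).1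
        simp only [Adm, Finset.forall_mem_insert, h1]
        refine and_congr ?_ ?_
        · rw [show ({c} : Finset s) = insert c ∅ from rfl, cnt_insert _ (by simp)]; simp
        · refine forall₂_congr fun d hd => ?_
          rw [h2 d hd, cnt_insert _ (h3 d), add_assoc]
      split_ifs with hS
      · rw [ih hw]
        refine Finset.sum_congr rfl fun B hB => ?_
        rw [Finset.mem_powerset] at hB
        simp only [hAdm B hB, hS, true_and]
        have hcB : c ∉ B := fun h => hcnw (hB h)
        split_ifs with hA
        · rw [cnt_insert _ hcB, add_assoc]
          congr 1
          have e : insert c w.toFinset \ insert c B = w.toFinset \ B := by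
            ext d
            simp only [Finset.mem_sdiff, Finset.mem_insert]
            constructor
            · rintro ⟨h | h, h2⟩
              · exact (h2 (Or.inl h)).elim
              · exact ⟨h, fun h' => h2 (Or.inr h')⟩
            · rintro ⟨h, h2⟩
              refine ⟨Or.inr h, ?_⟩
              rintro (rfl | h')
              · exact hcnw h
              · exact h2 h'
          rw [e]
          refine Finset.prod_congr rfl fun d hd => ?_
          rw [Finset.mem_sdiff] at hd
          have e2 : bef (insert c B) d = insert c (bef B d) := by
            rw [bef, Finset.filter_insert, if_pos (hcw d (by simpa using hd.1))]; rfl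
          rw [e2, cnt_insert T (B := bef B d) (fun h => hcB (Finset.mem_filter.mp h).1)]
          congr 2
          simp only [Pi.add_apply]; push_cast; ring
        · rfl
      · symm
        refine Finset.sum_eq_zero fun B hB => ?_
        rw [Finset.mem_powerset] at hB
        rw [if_neg]
        rw [hAdm B hB]; exact fun h => hS h.1

open Classical in
/-- The main expansion. -/
lemma expansion [IsDomain A] (hs : CConv s) (a b : ℤ → A) (x : Fin n → A) (k : Fin n → ℕ)
    (hk : StrictAnti k) :
    sgen n s x b * Alt (ek a k) x =
    ∑ p ∈ Finset.univ.filter (fun p : (s → Fin n) × Finset s => IsSsyt s p.1 ∧ Adm p.1 k p.2),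
      (∏ c : s, if c ∈ p.2 then 1 else
        (a ((k (p.1 c) : ℤ) + (cnt p.1 (bef p.2 c) (p.1 c) : ℕ) + 1) -
          b ((p.1 c : ℤ) + 1 + ((c : ℕ × ℕ).2 : ℤ) - ((c : ℕ × ℕ).1 : ℤ)))) *
          Alt (ek a (k + cnt p.1 p.2)) x := by
  by_cases hne : Nonempty (s → Fin n)
  swap
  · rw [not_nonempty_iff] at hne
    simp [sgen_eq]
  obtain ⟨T0⟩ := hne
  obtain ⟨β, hβ, hβ'⟩ := enum (Finset.univ : Finset s) _ rfl
  have hmem : ∀ c, c ∈ List.ofFn β := by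
    intro c
    rw [List.mem_ofFn']
    exact (hβ' c).mp (Finset.mem_univ c)
  have hpw : (List.ofFn β).Pairwise (fun c d : s => ColLT c d) := by
    rw [List.pairwise_ofFn]; exact fun i j h => hβ i j h
  have htf : (List.ofFn β).toFinset = Finset.univ := by
    ext c; simp only [List.mem_toFinset, hmem, Finset.mem_univ]
  have hC := cancel hs a b x (List.ofFn β) hpw (fun d hd => (hd (hmem d)).elim) T0 k hk
  rw [← Alt_mul_symm (fun y => sgen n s y b) _ (fun y σ => sgen_symm hs b y σ)]
  have e1 : ∀ y : Fin n → A, sgen n s y b * ek a k y =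
      ∑ T ∈ Finset.univ.filter (fun T : s → Fin n => IsSsyt s T ∧ ∀ c : s, c ∉ List.ofFn β → T c = T0 c),
        ((List.ofFn β).map fun c => cw b y (T c) c).prod * ek a k y := by
    intro y
    have nd : (List.ofFn β).Nodup := List.Pairwise.imp (fun {u v} h => by rintro rfl; exact ColLT_irrefl _ h) hpw
    rw [sgen_eq, ← Finset.sum_mul]
    congr 1
    refine Finset.sum_congr ?_ fun T _ => ?_
    · ext T
      simp only [Finset.mem_filter, hmem, not_true_eq_false, false_imp_iff, implies_true, and_true]
    · rw [← List.prod_toFinset _ nd, htf]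
      rfl
  simp only [e1]
  rw [Alt_sum, hC]
  simp only [unroll a x _ _ _ hpw, htf, Finset.powerset_univ]
  rw [Finset.sum_filter, Finset.sum_filter, ← Finset.univ_product_univ, Finset.sum_product]
  refine Finset.sum_congr rfl fun T _ => ?_
  by_cases hT : IsSsyt s T
  · simp only [hT, hmem, not_true_eq_false, false_imp_iff, implies_true, and_self, if_true, true_and]
    refine Finset.sum_congr rfl fun B _ => ?_
    split_ifs
    · congr 1
      rw [Finset.prod_ite, Finset.prod_const_one, one_mul]
      refine Finset.prod_congr ?_ fun _ _ => rfl
      ext c; simp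
    · rfl
  · simp [hT]

end Unroll


section YD
variable {n : ℕ}

open Classical in
/-- Young diagram with given row lengths -/
noncomputable def yd (l : Fin n → ℕ) : YoungDiagram :=
  if hl : Antitone l then
    ⟨cellsOf n l, by
      intro c d hdc hc
      rw [Finset.mem_coe, mem_cellsOf] at *
      obtain ⟨h, h2⟩ := hc
      have h3 : d.1 ≤ c.1 := hdc.1
      have h4 : d.2 ≤ c.2 := hdc.2
      exact ⟨by omega, lt_of_lt_of_le (lt_of_le_of_lt h4 h2) (hl (Fin.le_def.mpr h3))⟩⟩
  else ⊥

lemma yd_cells {l : Fin n → ℕ} (hl : Antitone l) : (yd l).cells = cellsOf n l := by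
  rw [yd, dif_pos hl]

lemma yd_rowLen {l : Fin n → ℕ} (hl : Antitone l) (r : Fin n) : (yd l).rowLen r = l r := by
  have h : ∀ j, j < (yd l).rowLen r ↔ j < l r := by
    intro j
    rw [← YoungDiagram.mem_iff_lt_rowLen, ← YoungDiagram.mem_cells, yd_cells hl, mem_cellsOf]
    simp
  have h1 := h (l r)
  have h2 := h ((yd l).rowLen r)
  omega

lemma colLen_le_iff (ν : YoungDiagram) : ν.colLen 0 ≤ n ↔ ∀ c ∈ ν, c.1 < n := by
  constructor
  · rintro h ⟨i, j⟩ hc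
    have h2 : (i, 0) ∈ ν := ν.up_left_mem le_rfl (Nat.zero_le _) hc
    rw [YoungDiagram.mem_iff_lt_colLen] at h2
    simp only; omega
  · intro h
    by_contra hc
    have h2 : (n, 0) ∈ ν := by rw [YoungDiagram.mem_iff_lt_colLen]; omega
    exact lt_irrefl _ (h _ h2)

lemma yd_colLen {l : Fin n → ℕ} (hl : Antitone l) : (yd l).colLen 0 ≤ n := by
  rw [colLen_le_iff]
  intro c hc
  rw [← YoungDiagram.mem_cells, yd_cells hl, mem_cellsOf] at hc
  exact hc.1

lemma rowLen_anti (ν : YoungDiagram) : Antitone (fun r : Fin n => ν.rowLen r) :=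
  fun _ _ h => ν.rowLen_anti _ _ h

lemma eq_yd {ν : YoungDiagram} (h : ν.colLen 0 ≤ n) {l : Fin n → ℕ}
    (hl : ∀ r : Fin n, ν.rowLen r = l r) : ν = yd l := by
  have e : (fun r : Fin n => ν.rowLen r) = l := funext hl
  subst e
  apply YoungDiagram.ext
  rw [yd_cells (rowLen_anti ν)]
  ext ⟨i, j⟩
  rw [mem_cellsOf, YoungDiagram.mem_cells]
  simp only
  constructor
  · intro hc
    exact ⟨(colLen_le_iff ν).mp h _ hc, YoungDiagram.mem_iff_lt_rowLen.mp hc⟩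
  · rintro ⟨_, h2⟩
    exact YoungDiagram.mem_iff_lt_rowLen.mpr h2

lemma card_eq_sum {ν : YoungDiagram} (h : ν.colLen 0 ≤ n) : ν.card = ∑ r : Fin n, ν.rowLen r := by
  have h1 : ∀ c ∈ ν.cells, c.1 ∈ Finset.range n := fun c hc =>
    Finset.mem_range.mpr ((colLen_le_iff ν).mp h c hc)
  rw [YoungDiagram.card, Finset.card_eq_sum_card_fiberwise h1, Finset.sum_range]
  refine Finset.sum_congr rfl fun r _ => ?_
  rw [YoungDiagram.rowLen_eq_card]
  rfl

lemma covers_step {σ τ : YoungDiagram} (h : Covers σ τ) (i : ℕ) :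
    τ.rowLen i = σ.rowLen i + if i = stepRow σ τ then 1 else 0 := by
  obtain ⟨h1, h2⟩ := h
  have hsub : σ.cells ⊆ τ.cells := h1
  have hc : (τ.cells \ σ.cells).card = 1 := by
    rw [Finset.card_sdiff_of_subset hsub]
    have : τ.cells.card = σ.cells.card + 1 := h2
    omega
  obtain ⟨c, hc⟩ := Finset.card_eq_one.mp hc
  have hs : stepRow σ τ = c.1 := by simp [stepRow, hc]
  have hcn : c ∉ σ.cells := by
    have : c ∈ τ.cells \ σ.cells := by rw [hc]; simp
    exact (Finset.mem_sdiff.mp this).2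
  have ht : τ.cells = insert c σ.cells := by
    rw [← Finset.sdiff_union_of_subset hsub, hc]; rfl
  rw [YoungDiagram.rowLen_eq_card, YoungDiagram.rowLen_eq_card, hs]
  simp only [YoungDiagram.row]
  rw [ht, Finset.filter_insert]
  by_cases hi : c.1 = i
  · rw [if_pos hi, Finset.card_insert_of_notMem (by simp [hcn]), if_pos hi.symm]
  · rw [if_neg hi, if_neg (Ne.symm hi)]; rfl

lemma yd_le {l l' : Fin n → ℕ} (hl : Antitone l) (hl' : Antitone l') (h : l ≤ l') : yd l ≤ yd l' := by
  intro c hc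
  rw [← YoungDiagram.mem_cells] at *
  rw [yd_cells hl, mem_cellsOf] at hc
  rw [yd_cells hl', mem_cellsOf]
  obtain ⟨h1, h2⟩ := hc
  exact ⟨h1, lt_of_lt_of_le h2 (h _)⟩

lemma yd_card {l : Fin n → ℕ} (hl : Antitone l) : (yd l).card = ∑ r, l r := by
  rw [card_eq_sum (yd_colLen hl)]
  simp only [yd_rowLen hl]

lemma yd_covers {l : Fin n → ℕ} {r : Fin n} (hl : Antitone l) (hl' : Antitone (l + Pi.single r 1)) :
    Covers (yd l) (yd (l + Pi.single r 1)) ∧ stepRow (yd l) (yd (l + Pi.single r 1)) = r := by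
  have h : Covers (yd l) (yd (l + Pi.single r 1)) := by
    refine ⟨yd_le hl hl' (by intro i; simp), ?_⟩
    rw [yd_card hl, yd_card hl']
    simp [Finset.sum_add_distrib]
  refine ⟨h, ?_⟩
  have := covers_step h r
  rw [yd_rowLen hl, yd_rowLen hl'] at this
  simp only [Pi.add_apply, Pi.single_eq_same] at this
  split_ifs at this with h3
  · exact h3.symm
  · omega

end YD

section Enum
variable {n m : ℕ} {s : Finset (ℕ × ℕ)}

/-- `β` enumerates `B` increasingly. -/
def Enums (β : Fin m → s) (B : Finset s) : Prop :=
  (∀ i j, i < j → ColLT (β i : ℕ × ℕ) (β j)) ∧ ∀ c, c ∈ B ↔ ∃ i, β i = c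

/-- partial contents of an enumeration -/
def cbeta (T : s → Fin n) (β : Fin m → s) (i : ℕ) : Fin n → ℕ :=
  fun r => (Finset.univ.filter (fun j : Fin m => (j : ℕ) < i ∧ T (β j) = r)).card

lemma cbeta_zero (T : s → Fin n) (β : Fin m → s) : cbeta T β 0 = 0 := by
  ext r; simp [cbeta]

lemma cbeta_succ (T : s → Fin n) (β : Fin m → s) (i : Fin m) :
    cbeta T β (i + 1) = cbeta T β i + Pi.single (T (β i)) 1 := by
  ext r
  simp only [cbeta, Pi.add_apply]
  by_cases h : T (β i) = r
  · have : Finset.univ.filter (fun j : Fin m => (j : ℕ) < i + 1 ∧ T (β j) = r) =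
        insert i (Finset.univ.filter (fun j : Fin m => (j : ℕ) < i ∧ T (β j) = r)) := by
      ext j
      simp only [Finset.mem_filter, Finset.mem_univ, true_and, Finset.mem_insert]
      constructor
      · rintro ⟨h1, h2⟩
        by_cases hj : j = i
        · exact Or.inl hj
        · right; refine ⟨?_, h2⟩
          have : (j : ℕ) ≠ i := fun h => hj (Fin.ext h)
          omega
      · rintro (rfl | h1)
        · exact ⟨by omega, h⟩
        · exact ⟨by omega, h1.2⟩
    rw [this, Finset.card_insert_of_notMem (by simp), h]
    simp
  · rw [Pi.single_eq_of_ne (Ne.symm h), add_zero]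
    congr 1
    ext j
    simp only [Finset.mem_filter, Finset.mem_univ, true_and]
    constructor
    · rintro ⟨h1, h2⟩
      have : (j : ℕ) ≠ i := fun h' => h (by rw [← Fin.ext h']; exact h2)
      exact ⟨by omega, h2⟩
    · rintro ⟨h1, h2⟩; exact ⟨by omega, h2⟩

lemma Enums.inj {β : Fin m → s} {B : Finset s} (h : Enums β B) : Function.Injective β := by
  intro i j hij
  by_contra hne
  rcases lt_or_gt_of_ne hne with h1 | h1
  · have := h.1 _ _ h1; rw [hij] at this; exact ColLT_irrefl _ this
  · have := h.1 _ _ h1; rw [hij] at this; exact ColLT_irrefl _ this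

lemma Enums.card_filter {β : Fin m → s} {B : Finset s} (h : Enums β B) (q : s → Prop) [DecidablePred q] :
    (B.filter q).card = (Finset.univ.filter (fun j => q (β j))).card := by
  classical
  rw [← Finset.card_image_of_injective _ h.inj]
  congr 1
  ext c
  simp only [Finset.mem_filter, Finset.mem_image, Finset.mem_univ, true_and, h.2]
  constructor
  · rintro ⟨⟨i, rfl⟩, h2⟩; exact ⟨i, h2, rfl⟩
  · rintro ⟨i, h2, rfl⟩; exact ⟨⟨i, rfl⟩, h2⟩

lemma Enums.card {β : Fin m → s} {B : Finset s} (h : Enums β B) : B.card = m := by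
  have := h.card_filter (fun _ => True)
  simpa using this

lemma Enums.lt_iff {β : Fin m → s} {B : Finset s} (h : Enums β B) (i j : Fin m) :
    ColLT (β i : ℕ × ℕ) (β j) ↔ i < j := by
  constructor
  · intro hc
    by_contra hn
    rcases (not_lt.mp hn).eq_or_lt with h1 | h1
    · rw [h1] at hc; exact ColLT_irrefl _ hc
    · exact ColLT_asymm hc (h.1 _ _ h1)
  · exact h.1 i j

lemma Enums.bef_card {β : Fin m → s} {B : Finset s} (h : Enums β B) (i : Fin m) :
    (bef B (β i)).card = i := by
  rw [bef, h.card_filter]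
  simp only [h.lt_iff]
  have : Finset.univ.filter (fun j => j < i) = Finset.Iio i := by ext j; simp
  rw [this, Fin.card_Iio]

/-- first `i` cells -/
def firstB (B : Finset s) (i : ℕ) : Finset s := B.filter (fun b => (bef B b).card < i)

lemma Enums.cnt_firstB {β : Fin m → s} {B : Finset s} (h : Enums β B) (T : s → Fin n) (i : ℕ) :
    cnt T (firstB B i) = cbeta T β i := by
  ext r
  simp only [cnt, firstB, cbeta, Finset.filter_filter]
  rw [h.card_filter]
  simp only [h.bef_card]

lemma Enums.cnt_befe {β : Fin m → s} {B : Finset s} (h : Enums β B) (T : s → Fin n) (i : Fin m) :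
    cnt T (befe B (β i)) = cbeta T β (i + 1) := by
  ext r
  simp only [cnt, befe, cbeta, Finset.filter_filter]
  rw [h.card_filter]
  simp only [h.lt_iff, not_lt]
  congr 1
  ext j
  simp only [Finset.mem_filter, Finset.mem_univ, true_and, Fin.le_def, Nat.lt_succ_iff]

lemma Enums.cnt_bef {β : Fin m → s} {B : Finset s} (h : Enums β B) (T : s → Fin n) (c : s) :
    cnt T (bef B c) = cbeta T β (Finset.univ.filter (fun i => ColLT (β i : ℕ × ℕ) c)).card := by
  set D := Finset.univ.filter (fun i => ColLT (β i : ℕ × ℕ) c) with hD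
  have hmem : ∀ j, j ∈ D ↔ ColLT (β j : ℕ × ℕ) c := by simp [hD]
  have key : ∀ j : Fin m, ColLT (β j : ℕ × ℕ) c ↔ (j : ℕ) < D.card := by
    intro j
    constructor
    · intro hj
      have hsub : Finset.Iic j ⊆ D := by
        intro i hi
        rw [Finset.mem_Iic] at hi
        rw [hmem]
        rcases hi.eq_or_lt with rfl | h1
        · exact hj
        · exact ColLT_trans (h.1 _ _ h1) hj
      have := Finset.card_le_card hsub
      rw [Fin.card_Iic] at this
      omega
    · intro hj
      by_contra hn
      have hsub : D ⊆ Finset.Iio j := by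
        intro i hi
        rw [hmem] at hi
        rw [Finset.mem_Iio]
        by_contra h1
        rcases (not_lt.mp h1).eq_or_lt with rfl | h1
        · exact hn hi
        · exact hn (ColLT_trans (h.1 _ _ h1) hi)
      have := Finset.card_le_card hsub
      rw [Fin.card_Iio] at this
      omega
  ext r
  simp only [cnt, bef, cbeta, Finset.filter_filter]
  rw [h.card_filter]
  simp only [key]

lemma Enums.cnt_all {β : Fin m → s} {B : Finset s} (h : Enums β B) (T : s → Fin n) :
    cnt T B = cbeta T β m := by
  ext r
  simp only [cnt, cbeta]
  rw [h.card_filter]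
  simp

lemma Enums.ext {β β' : Fin m → s} {B : Finset s} (h : Enums β B) (h' : Enums β' B) : β = β' := by
  ext1 i
  obtain ⟨j, hj⟩ := (h'.2 (β i)).mp ((h.2 _).mpr ⟨i, rfl⟩)
  have h1 := h.bef_card i
  rw [← hj, h'.bef_card] at h1
  rw [← hj, Fin.ext h1]

end Enum


section Final
variable {A : Type} [CommRing A] {n : ℕ} {s : Finset (ℕ × ℕ)}

lemma chainSet_iff {μ ν : YoungDiagram} {L : List YoungDiagram} :
    L ∈ chainSet μ ν ↔ 0 < L.length ∧ L.getD 0 ⊥ = μ ∧ L.getD (L.length - 1) ⊥ = ν ∧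
      ∀ i < L.length - 1, Covers (L.getD i ⊥) (L.getD (i + 1) ⊥) := by
  cases L with
  | nil => simp [chainSet]
  | cons c w =>
    have h1 : (c :: w).getD ((c :: w).length - 1) ⊥ = (c :: w).getLast (by simp) := by
      rw [List.getD_eq_getElem _ _ (by simp), List.getLast_eq_getElem]
    have h2 : List.IsChain Covers (c :: w) ↔ ∀ i < (c :: w).length - 1,
        Covers ((c :: w).getD i ⊥) ((c :: w).getD (i + 1) ⊥) := by
      rw [List.isChain_iff_getElem]
      constructor
      · intro h i hi
        have hi' : i + 1 < (c :: w).length := by omega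
        rw [List.getD_eq_getElem _ _ (by omega : i < (c :: w).length), List.getD_eq_getElem _ _ hi']
        exact h i hi'
      · intro h i hi
        have := h i (by omega)
        rwa [List.getD_eq_getElem _ _ (by omega : i < (c :: w).length), List.getD_eq_getElem _ _ hi] at this
    have h3 : (c :: w) ∈ chainSet μ ν ↔ List.IsChain Covers (c :: w) ∧ c = μ ∧ (c :: w).getLast (by simp) = ν := by
      simp only [chainSet, Set.mem_ofPred_eq, List.head?_cons, Option.some.injEq,
        List.getLast?_eq_some_getLast (List.cons_ne_nil c w)]
      exact Iff.rfl
    rw [h3, h1, h2]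
    simp only [List.length_cons, Nat.zero_lt_succ, List.getD_cons_zero, true_and]
    tauto

/-- the chain attached to a filling and a set of barred cells -/
noncomputable def chn (μ : YoungDiagram) (T : s → Fin n) (B : Finset s) : List YoungDiagram :=
  (List.range (B.card + 1)).map fun i => yd ((fun r : Fin n => μ.rowLen r) + cnt T (firstB B i))

lemma chn_length (μ : YoungDiagram) (T : s → Fin n) (B : Finset s) : (chn μ T B).length = B.card + 1 := by
  simp [chn]

lemma chn_getD (μ : YoungDiagram) (T : s → Fin n) (B : Finset s) {i : ℕ} (hi : i ≤ B.card) :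
    (chn μ T B).getD i ⊥ = yd ((fun r : Fin n => μ.rowLen r) + cnt T (firstB B i)) := by
  rw [List.getD_eq_getElem _ _ (by rw [chn_length]; omega)]
  simp [chn]

/-- shifted row lengths -/
def kmu (n : ℕ) (μ : YoungDiagram) : Fin n → ℕ := fun r => μ.rowLen r + (n - 1 - r)

lemma anti_of_strict (μ : YoungDiagram) (t : Fin n → ℕ) :
    StrictAnti (kmu n μ + t) ↔ Antitone ((fun r : Fin n => μ.rowLen r) + t) := by
  constructor
  · intro h
    have key : ∀ d : ℕ, ∀ i j : Fin n, (j : ℕ) = i + d →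
        kmu n μ j + t j + d ≤ kmu n μ i + t i := by
      intro d
      induction d with
      | zero => intro i j hij; rw [Fin.ext (by omega : (j : ℕ) = i)]; omega
      | succ d ih =>
        intro i j hij
        have q : (i : ℕ) + d < n := by omega
        have h1 := ih i ⟨i + d, q⟩ rfl
        have h2 := h (show (⟨i + d, q⟩ : Fin n) < j from Fin.lt_def.mpr (by simp; omega))
        simp only [Pi.add_apply] at h2
        omega
    intro i j hij
    have := key (j - i) i j (by have : (i : ℕ) ≤ j := hij; omega)
    have h3 : (i : ℕ) ≤ j := hij
    simp only [kmu, Pi.add_apply] at *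
    omega
  · intro h i j hij
    have := h hij.le
    have h3 : (i : ℕ) < j := hij
    simp only [kmu, Pi.add_apply] at *
    omega

lemma rows_chain {μ ν : YoungDiagram} {L : List YoungDiagram} (hL : L ∈ chainSet μ ν)
    {T : s → Fin n} {β : Fin (L.length - 1) → s}
    (hT : ∀ i : Fin (L.length - 1),
      (T (β i) : ℕ) = stepRow (L.getD (i : ℕ) ⊥) (L.getD ((i : ℕ) + 1) ⊥)) :
    ∀ i ≤ L.length - 1, ∀ r : Fin n, (L.getD i ⊥).rowLen r = μ.rowLen r + cbeta T β i r := by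
  rw [chainSet_iff] at hL
  obtain ⟨h0, h1, h2, h3⟩ := hL
  intro i
  induction i with
  | zero => intro _ r; rw [h1, cbeta_zero]; simp
  | succ i ih =>
    intro hi r
    rw [covers_step (h3 i (by omega)), ih (by omega) r]
    have e := cbeta_succ T β ⟨i, by omega⟩
    simp only at e
    rw [e, ← hT ⟨i, by omega⟩, Pi.add_apply, ← add_assoc]
    congr 1
    by_cases h : r = T (β ⟨i, by omega⟩)
    · rw [if_pos (by rw [h]), h, Pi.single_eq_same]
    · rw [if_neg (fun h' => h (Fin.ext h')), Pi.single_eq_of_ne h]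

lemma chain_colLen {μ ν : YoungDiagram} {L : List YoungDiagram} (hL : L ∈ chainSet μ ν)
    (hν : ν.colLen 0 ≤ n) (i : ℕ) (hi : i ≤ L.length - 1) : (L.getD i ⊥).colLen 0 ≤ n := by
  rw [chainSet_iff] at hL
  obtain ⟨h0, h1, h2, h3⟩ := hL
  have key : ∀ d i, i + d = L.length - 1 → L.getD i ⊥ ≤ ν := by
    intro d
    induction d with
    | zero => intro i hi; rw [← h2, ← hi]; exact le_rfl
    | succ d ih =>
      intro i hi
      exact le_trans (h3 i (by omega)).1 (ih (i + 1) (by omega))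
  rw [colLen_le_iff] at *
  exact fun c hc => hν c (key (L.length - 1 - i) i (by omega) hc)

open Classical in
/-- admissible pairs -/
noncomputable def GG (n : ℕ) (s : Finset (ℕ × ℕ)) (μ : YoungDiagram) : Finset ((s → Fin n) × Finset s) :=
  Finset.univ.filter (fun p => IsSsyt s p.1 ∧ Adm p.1 (kmu n μ) p.2)

lemma anti_first {μ : YoungDiagram} {T : s → Fin n} {B : Finset s} (hA : Adm T (kmu n μ) B)
    {m : ℕ} {β : Fin m → s} (hβ : Enums β B) (i : ℕ) (hi : i ≤ m) :
    Antitone ((fun r : Fin n => μ.rowLen r) + cbeta T β i) := by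
  cases i with
  | zero => rw [cbeta_zero, add_zero]; exact rowLen_anti μ
  | succ i =>
    have h := hA (β ⟨i, hi⟩) ((hβ.2 _).mpr ⟨_, rfl⟩)
    rw [hβ.cnt_befe, anti_of_strict] at h
    exact h

lemma chn_step {μ : YoungDiagram} {T : s → Fin n} {B : Finset s} (hA : Adm T (kmu n μ) B)
    {m : ℕ} {β : Fin m → s} (hβ : Enums β B) (i : Fin m) :
    Covers ((chn μ T B).getD i ⊥) ((chn μ T B).getD (i + 1) ⊥) ∧
    stepRow ((chn μ T B).getD i ⊥) ((chn μ T B).getD (i + 1) ⊥) = T (β i) := by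
  have hm := hβ.card
  rw [chn_getD _ _ _ (by omega), chn_getD _ _ _ (by omega), hβ.cnt_firstB, hβ.cnt_firstB]
  have h1 := anti_first hA hβ i (by omega)
  have h2 := anti_first hA hβ (i + 1) (by omega)
  rw [cbeta_succ, ← add_assoc] at *
  exact yd_covers h1 h2

lemma chn_mem {μ : YoungDiagram} (hμ : μ.colLen 0 ≤ n) {T : s → Fin n} {B : Finset s}
    (hA : Adm T (kmu n μ) B) :
    chn μ T B ∈ chainSet μ (yd ((fun r : Fin n => μ.rowLen r) + cnt T B)) := by
  obtain ⟨β, hβ⟩ := enum B _ rfl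
  have hβ : Enums β B := hβ
  rw [chainSet_iff, chn_length]
  refine ⟨by omega, ?_, ?_, ?_⟩
  · rw [chn_getD _ _ _ (by omega), hβ.cnt_firstB, cbeta_zero, add_zero]
    exact (eq_yd hμ (fun r => rfl)).symm
  · rw [chn_getD _ _ _ (by omega), hβ.cnt_firstB, hβ.cnt_all]
    rfl
  · intro i hi
    exact (chn_step hA hβ ⟨i, by omega⟩).1

open Classical in
/-- weight of a pair -/
noncomputable def wtt (a b : ℤ → A) (μ : YoungDiagram) (p : (s → Fin n) × Finset s) : A :=
  ∏ c : s, if c ∈ p.2 then 1 else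
        (a ((kmu n μ (p.1 c) : ℤ) + (cnt p.1 (bef p.2 c) (p.1 c) : ℕ) + 1) -
          b ((p.1 c : ℤ) + 1 + ((c : ℕ × ℕ).2 : ℤ) - ((c : ℕ × ℕ).1 : ℤ)))

open Classical in
lemma Sbar_eq (a b : ℤ → A) {μ ν : YoungDiagram} {L : List YoungDiagram} (hL : L ∈ chainSet μ ν)
    (hν : ν.colLen 0 ≤ n) :
    Sbar n s a b L = ∑ p ∈ (GG n s μ).filter (fun p => chn μ p.1 p.2 = L), wtt a b μ p := by
  have hL0 := (chainSet_iff.mp hL).1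
  have henum : ∀ p ∈ TSet (n := n) s L, Enums p.2 (Finset.univ.image p.2) := by
    intro p hp
    exact ⟨hp.2.1, fun c => by simp⟩
  rw [Sbar, ← finsum_mem_coe_finset]
  refine finsum_mem_eq_of_bijOn (fun p => (p.1, Finset.univ.image p.2)) ⟨?_, ?_, ?_⟩ ?_
  · rintro ⟨T, β⟩ hp
    have hE := henum _ hp
    have hr := rows_chain hL hp.2.2
    have hcol := chain_colLen hL hν
    simp only at hE hr
    have heq : ∀ i ≤ L.length - 1, L.getD i ⊥ = yd ((fun r : Fin n => μ.rowLen r) + cbeta T β i) :=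
      fun i hi => eq_yd (hcol i hi) (hr i hi)
    have hanti : ∀ i ≤ L.length - 1, Antitone ((fun r : Fin n => μ.rowLen r) + cbeta T β i) := by
      intro i hi
      have : ((fun r : Fin n => μ.rowLen r) + cbeta T β i) = fun r : Fin n => (L.getD i ⊥).rowLen r :=
        funext fun r => (hr i hi r).symm
      rw [this]; exact rowLen_anti _
    simp only [Finset.coe_filter, GG, Finset.mem_filter, Finset.mem_univ, true_and, Set.mem_ofPred_eq]
    refine ⟨⟨hp.1, ?_⟩, ?_⟩
    · intro c hc
      obtain ⟨i, rfl⟩ := (hE.2 c).mp hc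
      rw [hE.cnt_befe, anti_of_strict]
      exact hanti _ (by omega)
    · have hc := hE.card
      refine List.ext_getElem (by rw [chn_length, hc]; omega) fun i h1 h2 => ?_
      have h3 := heq i (by omega)
      rw [List.getD_eq_getElem _ _ h2] at h3
      rw [h3, ← hE.cnt_firstB]
      simp [chn]
  · rintro ⟨T, β⟩ hp ⟨T', β'⟩ hp' h
    have hE := henum _ hp
    have hE' := henum _ hp'
    simp only [Prod.mk.injEq] at h hE hE'
    rw [← h.2] at hE'
    rw [h.1, hE.ext hE']
  · rintro ⟨T, B⟩ hp
    simp only [Finset.coe_filter, GG, Finset.mem_filter, Finset.mem_univ, true_and, Set.mem_ofPred_eq] at hp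
    obtain ⟨⟨h1, h2⟩, rfl⟩ := hp
    obtain ⟨β, hβ⟩ := enum B ((chn μ T B).length - 1) (by rw [chn_length]; omega)
    have hβ : Enums β B := hβ
    refine ⟨(T, β), ⟨h1, hβ.1, fun i => (chn_step h2 hβ i).2.symm⟩, ?_⟩
    simp only [Prod.mk.injEq, true_and]
    ext c
    simp [hβ.2]
  · rintro ⟨T, β⟩ hp
    have hE := henum _ hp
    have hr := rows_chain hL hp.2.2
    simp only at hE hr
    rw [wtt]
    refine Finset.prod_congr rfl fun c _ => ?_
    simp only [hE.2 c]
    split_ifs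
    · rfl
    · rw [hE.cnt_bef, subA, rhoOf, hr _ (by simpa using Finset.card_le_univ (Finset.univ.filter (fun i => ColLT (β i : ℕ × ℕ) c)))]
      congr 2
      have := (T c).2
      simp only [kmu]
      push_cast
      rw [Nat.cast_sub (by omega), Nat.cast_sub (by omega)]
      push_cast; ring

open Classical in
lemma finsum_fiber {ι κ : Type*} (S : Set κ) (G : Finset ι) (φ : ι → κ) (hφ : ∀ i ∈ G, φ i ∈ S)
    (f : κ → A) (w : ι → A) (hf : ∀ q ∈ S, f q = ∑ i ∈ G.filter (fun i => φ i = q), w i) :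
    ∑ᶠ q ∈ S, f q = ∑ i ∈ G, w i := by
  rw [finsum_mem_eq_sum_of_subset (t := G.image φ)]
  · rw [← Finset.sum_fiberwise_of_maps_to (s := G) (t := G.image φ) (g := φ)
      (fun i hi => Finset.mem_image_of_mem _ hi)]
    refine Finset.sum_congr rfl fun q hq => hf q ?_
    obtain ⟨i, hi, rfl⟩ := Finset.mem_image.mp hq
    exact hφ i hi
  · rintro q ⟨hq, hq2⟩
    by_contra hn
    apply hq2
    rw [hf q hq, Finset.filter_false_of_mem, Finset.sum_empty]
    rintro i hi rfl
    exact hn (Finset.mem_coe.mpr (Finset.mem_image_of_mem _ hi))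
  · intro q hq
    obtain ⟨i, hi, rfl⟩ := Finset.mem_image.mp (Finset.mem_coe.mp hq)
    exact hφ i hi

lemma sgen_yd (a : ℤ → A) (x : Fin n → A) {ν : YoungDiagram} (hν : ν.colLen 0 ≤ n) :
    Dd a n (kap _ fun _ => 0) (fun i => x i.rev) * sgen n ν.cells x a = Alt (ek a (kmu n ν)) x := by
  have h : ν.cells = cellsOf n (fun r : Fin n => ν.rowLen r) := by
    rw [← yd_cells (rowLen_anti ν), ← eq_yd hν (fun r => rfl)]
  rw [h, bialternant a n _ (rowLen_anti ν), Dd_eq_Alt]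
  rfl

lemma cnt_sum (T : s → Fin n) (B : Finset s) : ∑ r, cnt T B r = B.card := by
  simp only [cnt]
  exact (Finset.card_eq_sum_card_fiberwise (fun _ _ => Finset.mem_coe.mpr (Finset.mem_univ _))).symm

open Classical in
theorem LR_general [IsDomain A] (hs : CConv s) (a b : ℤ → A) (x : Fin n → A)
    (hx : Function.Injective x) (μ : YoungDiagram) (hμ : μ.colLen 0 ≤ n) :
    sgen n s x b * sgen n μ.cells x a =
    ∑ᶠ ν ∈ {ν : YoungDiagram | μ ≤ ν ∧ ν.colLen 0 ≤ n ∧ ν.card ≤ s.card + μ.card},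
      (∑ᶠ L ∈ chainSet μ ν, Sbar n s a b L) * sgen n ν.cells x a := by
  apply mul_left_cancel₀ (vand_ne_zero a n x hx)
  rw [mul_left_comm, sgen_yd a x hμ, expansion hs a b x (kmu n μ) ((anti_of_strict μ 0).mpr (rowLen_anti μ))]
  set S := {ν : YoungDiagram | μ ≤ ν ∧ ν.colLen 0 ≤ n ∧ ν.card ≤ s.card + μ.card} with hS
  have hanti : ∀ p ∈ GG n s μ, Antitone ((fun r : Fin n => μ.rowLen r) + cnt p.1 p.2) := by
    intro p hp
    simp only [GG, Finset.mem_filter, Finset.mem_univ, true_and] at hp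
    obtain ⟨β, hβ⟩ := enum p.2 _ rfl
    have hβ : Enums β p.2 := hβ
    rw [hβ.cnt_all]
    exact anti_first hp.2 hβ _ le_rfl
  have hmap : ∀ p ∈ GG n s μ, yd ((fun r : Fin n => μ.rowLen r) + cnt p.1 p.2) ∈ S := by
    intro p hp
    have h := hanti p hp
    refine ⟨?_, yd_colLen h, ?_⟩
    · conv_lhs => rw [eq_yd hμ (fun r => rfl)]
      exact yd_le (rowLen_anti μ) h (fun r => by simp)
    · rw [yd_card h, card_eq_sum hμ]
      simp only [Pi.add_apply, Finset.sum_add_distrib, cnt_sum]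
      have := Finset.card_le_univ p.2
      simp at this
      omega
  rw [finsum_fiber S (GG n s μ) (fun p => yd ((fun r : Fin n => μ.rowLen r) + cnt p.1 p.2)) hmap _
    (fun p => wtt a b μ p * sgen n (yd ((fun r : Fin n => μ.rowLen r) + cnt p.1 p.2)).cells x a)]
  · rw [Finset.mul_sum]
    refine Finset.sum_congr rfl fun p hp => ?_
    have h := hanti p hp
    rw [mul_left_comm, sgen_yd a x (yd_colLen h)]
    have e : kmu n (yd ((fun r : Fin n => μ.rowLen r) + cnt p.1 p.2)) = kmu n μ + cnt p.1 p.2 := by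
      ext r
      simp only [kmu, yd_rowLen h, Pi.add_apply]
      omega
    rw [e]
    rfl
  · intro ν hν
    rw [finsum_fiber (chainSet μ ν) ((GG n s μ).filter (fun p => yd ((fun r : Fin n => μ.rowLen r) + cnt p.1 p.2) = ν))
      (fun p => chn μ p.1 p.2) _ _ (fun p => wtt a b μ p)]
    · rw [Finset.sum_mul]
      refine Finset.sum_congr rfl fun p hp => ?_
      rw [(Finset.mem_filter.mp hp).2]
    · intro L hL
      rw [Sbar_eq a b hL hν.2.1, Finset.filter_filter]
      refine Finset.sum_congr ?_ fun _ _ => rfl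
      ext p
      simp only [Finset.mem_filter]
      refine and_congr_right fun hp => ⟨fun h => ⟨?_, h⟩, fun h => h.2⟩
      simp only [GG, Finset.mem_filter, Finset.mem_univ, true_and] at hp
      have h1 := chn_mem hμ hp.2
      rw [h] at h1
      rw [← (chainSet_iff.mp h1).2.2.1, ← (chainSet_iff.mp hL).2.2.1]
    · intro p hp
      obtain ⟨h1, h2⟩ := Finset.mem_filter.mp hp
      simp only [GG, Finset.mem_filter, Finset.mem_univ, true_and] at h1
      rw [← h2]
      exact chn_mem hμ h1.2

end Final

/-- **Littlewood–Richardson rule for factorial Schur functions.**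
In `ℤ[a_i, b_i : i ∈ ℤ][x_1,…,x_n]` (with `a_k`, `b_k`, `x_i` the indicated generators),
`s_θ(x|b)·s_μ(x|a) = Σ_ν c^ν_{θμ}(a,b)·s_ν(x|a)`, summed over partitions `ν ⊇ μ` with at
most `n` parts and `|ν| ≤ |θ| + |μ|`, where
`c^ν_{θμ}(a,b) = Σ_R 𝒮(R) = Σ_{T ∈ 𝒯(θ,ν/μ)} ∏_{α unbarred} ((a_{ρ(α)})_{T(α)} − b_{T(α)+c(α)})`. -/
theorem factorial_LR_rule (n : ℕ) (hn : 1 ≤ n) (θi θo : YoungDiagram) (hθ : θi ≤ θo)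
    (mu : YoungDiagram) (hmu : mu.colLen 0 ≤ n) :
    sgen n (skewCells θi θo)
        (fun i => (MvPolynomial.X (Sum.inr (Sum.inr i)) : MvPolynomial (ℤ ⊕ ℤ ⊕ Fin n) ℤ))
        (fun k => MvPolynomial.X (Sum.inr (Sum.inl k))) *
      sgen n mu.cells (fun i => MvPolynomial.X (Sum.inr (Sum.inr i)))
        (fun k => MvPolynomial.X (Sum.inl k)) =
    ∑ᶠ nu ∈ {nu : YoungDiagram | mu ≤ nu ∧ nu.colLen 0 ≤ n ∧
        nu.card ≤ (skewCells θi θo).card + mu.card},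
      (∑ᶠ L ∈ chainSet mu nu,
        Sbar n (skewCells θi θo) (fun k => MvPolynomial.X (Sum.inl k))
          (fun k => MvPolynomial.X (Sum.inr (Sum.inl k))) L) *
        sgen n nu.cells (fun i => MvPolynomial.X (Sum.inr (Sum.inr i)))
          (fun k => MvPolynomial.X (Sum.inl k)) := by
  exact LR_general (skew_conv θi θo) _ _ _
    (fun i j h => Sum.inr_injective (Sum.inr_injective (MvPolynomial.X_injective h))) mu hmu

end FactorialLR
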